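/- arXiv:1701.04734 — 4 statements merged into one kernel-verified Lean document; each statement's English description precedes it below -/
import Mathlib

section
/- Let Δ be a simplicial complex on the vertex set X = {x_1,…,x_n}, let β = (k_1,…,k_n) ∈ ℕ^n be a vector of positive integers, let 1 ≤ i ≤ n, and let α = β + δ_i (where δ_i is the i-th standard unit vector). Then the expansion (Δ^β)^{1+δ_{ik_i}} of Δ^β with respect to the vector which is 1 in every coordinate except for the coordinate of the vertex x_{ik_i}, where it is 2, is isomorphic as a simplicial complex to Δ^α; an explicit isomorphism is induced by the vertex map sending x_{rst} to x_{rs} if t = 1 and to x_{i(k_i+1)} if t = 2. -/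
/-- An (abstract) simplicial complex: a collection of finite subsets of the vertex set
closed under taking subsets. -/
def IsComplex {V : Type*} (Δ : Set (Finset V)) : Prop :=
  ∀ ⦃F G : Finset V⦄, F ∈ Δ → G ⊆ F → G ∈ Δ

/-- The faces of the expansion `⟨F⟩^α` of the simplex with facet `F`: its facets are all the
sets obtained by picking, for each vertex `v ∈ F`, one of the copies `v_1, …, v_{α v}`. -/
def simplexExpansion {V : Type*} [DecidableEq V] (F : Finset V) (α : V → ℕ) :
    Set (Finset ((v : V) × Fin (α v))) :=
  {G | G.image Sigma.fst ⊆ F ∧ Set.InjOn Sigma.fst (G : Set ((v : V) × Fin (α v)))}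

/-- The expansion `Δ^α` of a simplicial complex `Δ` with respect to `α`. -/
def expansion {V : Type*} [DecidableEq V] (Δ : Set (Finset V)) (α : V → ℕ) :
    Set (Finset ((v : V) × Fin (α v))) :=
  ⋃ F ∈ Δ, simplexExpansion F α

theorem Set.injOn_comp_iff_injOn_image {X Y Z : Type*} {f : X → Y} {g : Y → Z} {s : Set X} :
    Set.InjOn (g ∘ f) s ↔ Set.InjOn f s ∧ Set.InjOn g (f '' s) :=
  ⟨fun h => ⟨fun _ hx _ hy e => h hx hy (congrArg g e), h.image_of_comp⟩,
    fun h => h.2.comp h.1 (Set.mapsTo_image f s)⟩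

theorem Sigma.ext_fin_val {V : Type*} {α : V → ℕ} {x y : (v : V) × Fin (α v)}
    (h₁ : x.1 = y.1) (h₂ : x.2.val = y.2.val) : x = y := by
  obtain ⟨v, s⟩ := x
  obtain ⟨w, t⟩ := y
  obtain rfl : v = w := h₁
  exact congrArg (Sigma.mk v) (Fin.ext h₂)

theorem IsComplex.mem_expansion_iff {V : Type*} [DecidableEq V] {Δ : Set (Finset V)}
    (hΔ : IsComplex Δ) {α : V → ℕ} {G : Finset ((v : V) × Fin (α v))} :
    G ∈ expansion Δ α ↔
      G.image Sigma.fst ∈ Δ ∧ Set.InjOn Sigma.fst (G : Set ((v : V) × Fin (α v))) := by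
  simp only [expansion, simplexExpansion, Set.mem_iUnion, Set.mem_ofPred_eq, exists_prop]
  constructor
  · rintro ⟨F, hF, hG, hinj⟩
    exact ⟨hΔ hF hG, hinj⟩
  · rintro ⟨hG, hinj⟩
    exact ⟨_, hG, subset_rfl, hinj⟩

theorem IsComplex.expansion {V : Type*} [DecidableEq V] {Δ : Set (Finset V)}
    (hΔ : IsComplex Δ) (α : V → ℕ) : IsComplex (expansion Δ α) := by
  intro F G hF hGF
  rw [hΔ.mem_expansion_iff] at hF ⊢
  exact ⟨hΔ hF.1 (Finset.image_subset_image hGF), hF.2.mono (Finset.coe_subset.2 hGF)⟩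

/-- if `α = β + δ_i`, then `(Δ^β)^{1+δ_{i k_i}} ≅ Δ^α`, an explicit isomorphism
being induced by the vertex map sending `x_{rst}` to `x_{rs}` if `t = 1` and to
`x_{i(k_i+1)}` if `t = 2`. -/
theorem expansion_expansion_iso (n : ℕ) (Δ : Set (Finset (Fin n))) (hΔ : IsComplex Δ)
    (β : Fin n → ℕ) (hβ : ∀ j, 1 ≤ β j) (i : Fin n)
    -- `γ` is the vector which is `1` everywhere except at the vertex `x_{i k_i}`
    -- (the last copy of `x_i` in `X^β`), where it is `2`
    (γ : ((r : Fin n) × Fin (β r)) → ℕ)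
    (hγ : ∀ v : (r : Fin n) × Fin (β r),
      γ v = if v.1 = i ∧ v.2.val = β i - 1 then 2 else 1)
    -- the explicit vertex map
    (φ : ((v : (r : Fin n) × Fin (β r)) × Fin (γ v)) →
      ((r : Fin n) × Fin (β r + if r = i then 1 else 0)))
    (hφ : ∀ (v : (r : Fin n) × Fin (β r)) (t : Fin (γ v)),
      φ ⟨v, t⟩ = if t.val = 0
        then ⟨v.1, Fin.castLE (Nat.le_add_right _ _) v.2⟩
        else ⟨i, ⟨β i, by simp⟩⟩) :
    Function.Bijective φ ∧
      ∀ G : Finset ((v : (r : Fin n) × Fin (β r)) × Fin (γ v)),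
        G ∈ expansion (expansion Δ β) γ ↔
          G.image φ ∈ expansion Δ (fun r => β r + if r = i then 1 else 0) := by
  have hfst : ∀ x, (φ x).1 = x.1.1 := by
    rintro ⟨v, t⟩
    have ht := t.isLt.trans_eq (hγ v)
    rw [hφ]
    grind
  have hsnd : ∀ x, (φ x).2.val = if x.2.val = 0 then x.1.2.val else β i := by
    rintro ⟨v, t⟩
    by_cases ht : t.val = 0
    · rw [(hφ v t).trans (if_pos ht), if_pos ht]
      rfl
    · rw [(hφ v t).trans (if_neg ht), if_neg ht]
  have hcopy : ∀ x : (v : (r : Fin n) × Fin (β r)) × Fin (γ v), x.2.val ≠ 0 →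
      x.1.1 = i ∧ x.1.2.val = β i - 1 ∧ x.2.val = 1 := by
    rintro ⟨v, t⟩ h
    have ht := t.isLt.trans_eq (hγ v)
    grind
  have hinj : Function.Injective φ := by
    intro x y hxy
    have h₁ : x.1.1 = y.1.1 := by rw [← hfst, ← hfst, hxy]
    have h₂ : (φ x).2.val = (φ y).2.val := by rw [hxy]
    rw [hsnd, hsnd] at h₂
    have hx := x.1.2.isLt
    have hy := y.1.2.isLt
    have hβ₁ : β x.1.1 = β y.1.1 := by rw [h₁]
    have hxi : x.2.val ≠ 0 → β x.1.1 = β i := fun h => by rw [(hcopy x h).1]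
    have hyi : y.2.val ≠ 0 → β y.1.1 = β i := fun h => by rw [(hcopy y h).1]
    have hx' := hcopy x
    have hy' := hcopy y
    refine Sigma.ext_fin_val (Sigma.ext_fin_val h₁ ?_) ?_ <;> split_ifs at h₂ <;> omega
  have hsurj : Function.Surjective φ := by
    rintro ⟨r, s⟩
    have hs := s.isLt
    by_cases hsr : s.val < β r
    · have hpos : 0 < γ ⟨r, ⟨s, hsr⟩⟩ := by rw [hγ]; positivity
      exact ⟨⟨⟨r, ⟨s, hsr⟩⟩, ⟨0, hpos⟩⟩,
        Sigma.ext_fin_val (hfst _) ((hsnd _).trans (if_pos rfl))⟩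
    · obtain rfl : r = i := by
        by_contra hr
        simp only [if_neg hr] at hs
        omega
      simp only [if_true] at hs
      have hlast : β r - 1 < β r := Nat.sub_lt (hβ r) one_pos
      have htwo : 1 < γ ⟨r, ⟨β r - 1, hlast⟩⟩ := by simp [hγ]
      refine ⟨⟨⟨r, ⟨β r - 1, hlast⟩⟩, ⟨1, htwo⟩⟩,
        Sigma.ext_fin_val (hfst _) ((hsnd _).trans ?_)⟩
      rw [if_neg one_ne_zero]
      exact (by omega : β r = s.val)
  refine ⟨⟨hinj, hsurj⟩, fun G => ?_⟩
  have hcomp : Sigma.fst ∘ φ = Sigma.fst ∘ Sigma.fst := funext hfst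
  rw [(hΔ.expansion β).mem_expansion_iff, hΔ.mem_expansion_iff, hΔ.mem_expansion_iff,
    Finset.image_image, Finset.image_image, hcomp, Finset.coe_image, Finset.coe_image,
    and_assoc, and_comm (a := Set.InjOn _ _), ← Set.injOn_comp_iff_injOn_image, ← hcomp,
    Set.injOn_comp_iff_injOn_image, and_iff_right hinj.injOn]
end

section
/- Let Δ be a simplicial complex on X = {x_1,…,x_n}, let K be a field, and let α = (k_1,…,k_n) ∈ ℕ^n with all k_i ≥ 1. Then in the polynomial ring S^α = K[x_{ij} : 1 ≤ i ≤ n, 1 ≤ j ≤ k_i], the ideal J_{Δ^α} = ⋂_{F ∈ 𝔉(Δ^α)} P_F equals the ideal generated by the monomials ∏_{j=1}^{k_{i_1}} x_{i_1 j} ⋯ ∏_{j=1}^{k_{i_r}} x_{i_r j}, where x_{i_1}⋯x_{i_r} ranges over the squarefree monomials lying in J_Δ = ⋂_{F ∈ 𝔉(Δ)} P_F ⊆ S = K[x_1,…,x_n]. -/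
/-- `F` is a facet (maximal face) of `Δ`. -/
def IsFacet {V : Type*} (Δ : Set (Finset V)) (F : Finset V) : Prop :=
  F ∈ Δ ∧ ∀ G ∈ Δ, F ⊆ G → F = G

/-- `P_F`, the ideal generated by the variables belonging to `F`. -/
noncomputable def varIdeal (K : Type*) [Field K] {V : Type*} (F : Finset V) :
    Ideal (MvPolynomial V K) :=
  Ideal.span (MvPolynomial.X '' (F : Set V))

/-- `J_Δ = ⋂_{F ∈ 𝔉(Δ)} P_F`, the Alexander dual of the facet ideal of `Δ`. -/
noncomputable def dualFacetIdeal (K : Type*) [Field K] {V : Type*} (Δ : Set (Finset V)) :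
    Ideal (MvPolynomial V K) :=
  ⨅ F ∈ {F | IsFacet Δ F}, varIdeal K F

theorem X_mem_varIdeal (K : Type*) [Field K] {V : Type*} {F : Finset V} {v : V} (hv : v ∈ F) :
    (MvPolynomial.X v : MvPolynomial V K) ∈ varIdeal K F :=
  Ideal.subset_span (Set.mem_image_of_mem _ (Finset.mem_coe.2 hv))

theorem prod_X_mem_varIdeal_iff (K : Type*) [Field K] {V : Type*} {E F : Finset V} :
    (∏ j ∈ E, (MvPolynomial.X j : MvPolynomial V K)) ∈ varIdeal K F ↔ ∃ v ∈ E, v ∈ F := by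
  classical
  refine ⟨fun h => ?_, fun ⟨v, hE, hF⟩ =>
    Ideal.mem_of_dvd _ (Finset.dvd_prod_of_mem _ hE) (X_mem_varIdeal K hF)⟩
  let φ : MvPolynomial V K →+* K := MvPolynomial.eval fun v => if v ∈ F then 0 else 1
  have hker : varIdeal K F ≤ RingHom.ker φ := by
    refine Ideal.span_le.2 ?_
    rintro _ ⟨v, hv, rfl⟩
    simpa [φ, RingHom.mem_ker] using hv
  have h0 : φ (∏ j ∈ E, MvPolynomial.X j) = 0 := hker h
  rw [map_prod, Finset.prod_eq_zero_iff] at h0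
  simpa [φ] using h0

theorem mem_dualFacetIdeal (K : Type*) [Field K] {V : Type*} {Δ : Set (Finset V)}
    {f : MvPolynomial V K} :
    f ∈ dualFacetIdeal K Δ ↔ ∀ F, IsFacet Δ F → f ∈ varIdeal K F := by
  simp [dualFacetIdeal, Submodule.mem_iInf]

theorem mem_expansion {V : Type*} [DecidableEq V] {Δ : Set (Finset V)} {α : V → ℕ}
    {G : Finset ((v : V) × Fin (α v))} :
    G ∈ expansion Δ α ↔ ∃ F ∈ Δ, G.image Sigma.fst ⊆ F ∧
      Set.InjOn Sigma.fst (G : Set ((v : V) × Fin (α v))) := by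
  simp [expansion, simplexExpansion, and_left_comm]

/-- The projection to `Δ` of a facet of `Δ^α` is a facet. -/
theorem IsFacet.image_fst {V : Type*} [DecidableEq V] {Δ : Set (Finset V)} (hΔ : IsComplex Δ)
    {α : V → ℕ} (hα : ∀ v, 1 ≤ α v) {G : Finset ((v : V) × Fin (α v))}
    (hG : IsFacet (expansion Δ α) G) : IsFacet Δ (G.image Sigma.fst) := by
  obtain ⟨F, hF, hGF, hinj⟩ := mem_expansion.1 hG.1
  refine ⟨hΔ hF hGF, fun H hH hGH => hGH.antisymm fun v hv => ?_⟩
  by_contra hvG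
  let p : (v : V) × Fin (α v) := ⟨v, ⟨0, hα v⟩⟩
  have hp : p ∉ G := fun h => hvG (Finset.mem_image_of_mem Sigma.fst h)
  have hins : insert p G ∈ expansion Δ α := by
    refine mem_expansion.2 ⟨H, hH, ?_, ?_⟩
    · rw [Finset.image_insert]
      exact Finset.insert_subset hv hGH
    · rw [Finset.coe_insert, Set.injOn_insert (by simpa using hp)]
      exact ⟨hinj, by simpa [p] using hvG⟩
  exact hp (hG.2 _ hins (Finset.subset_insert p G) ▸ Finset.mem_insert_self p G)

/-- Every section over a facet of `Δ` is a facet of `Δ^α`. -/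
theorem IsFacet.image_section {V : Type*} [DecidableEq V] {Δ : Set (Finset V)} {α : V → ℕ}
    {F : Finset V} (hF : IsFacet Δ F) (s : (v : V) → Fin (α v)) :
    IsFacet (expansion Δ α) (F.image fun v => ⟨v, s v⟩) := by
  refine ⟨mem_expansion.2 ⟨F, hF.1, ?_, ?_⟩, fun G hG hFG => hFG.antisymm ?_⟩
  · simp [Finset.image_image, Function.comp_def]
  · simp only [Finset.coe_image]
    rintro _ ⟨v, -, rfl⟩ _ ⟨w, -, rfl⟩ (rfl : v = w)
    rfl
  · obtain ⟨F', hF', hGF', hinj⟩ := mem_expansion.1 hG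
    have hFF' : F = F' := hF.2 _ hF' fun v hv =>
      hGF' (Finset.mem_image_of_mem Sigma.fst (hFG (Finset.mem_image_of_mem _ hv)))
    intro p hp
    have hpF : p.1 ∈ F := hFF' ▸ hGF' (Finset.mem_image_of_mem Sigma.fst hp)
    have hsec := Finset.mem_image_of_mem (fun v => (⟨v, s v⟩ : (v : V) × Fin (α v))) hpF
    rwa [hinj hp (hFG hsec) rfl]

/-- `J_{Δ^α}` is generated by the monomials
`∏_{j=1}^{k_{i_1}} x_{i_1 j} ⋯ ∏_{j=1}^{k_{i_r}} x_{i_r j}` where the squarefree monomial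
`x_{i_1}⋯x_{i_r}` ranges over the squarefree monomials lying in `J_Δ`. -/
theorem dualFacetIdeal_expansion (n : ℕ) (K : Type*) [Field K]
    (Δ : Set (Finset (Fin n))) (hΔ : IsComplex Δ)
    (α : Fin n → ℕ) (hα : ∀ i, 1 ≤ α i) :
    dualFacetIdeal K (expansion Δ α) =
      Ideal.span {m : MvPolynomial ((i : Fin n) × Fin (α i)) K |
        ∃ F : Finset (Fin n),
          (∏ j ∈ F, MvPolynomial.X j) ∈ dualFacetIdeal K Δ ∧
          m = ∏ j ∈ F, ∏ t : Fin (α j),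
            MvPolynomial.X (⟨j, t⟩ : (i : Fin n) × Fin (α i))} := by
  apply le_antisymm
  · intro f hf
    rw [mem_dualFacetIdeal] at hf
    rw [f.as_sum]
    refine Ideal.sum_mem _ fun m hm => ?_
    let E : Finset (Fin n) := {v | ∀ t : Fin (α v), m ⟨v, t⟩ ≠ 0}
    have hdvd : (∏ j ∈ E, ∏ t : Fin (α j), MvPolynomial.X ⟨j, t⟩) ∣
        MvPolynomial.monomial m (f.coeff m) := by
      rw [MvPolynomial.monomial_eq, Finsupp.prod_fintype _ _ fun _ => pow_zero _,
        Fintype.prod_sigma]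
      refine Dvd.dvd.mul_left ((Finset.prod_dvd_prod_of_dvd _ _ fun j hj => ?_).trans
        (Finset.prod_dvd_prod_of_subset _ _ _ (Finset.subset_univ E))) _
      exact Finset.prod_dvd_prod_of_dvd _ _ fun t _ =>
        dvd_pow_self _ ((Finset.mem_filter.1 hj).2 t)
    refine Ideal.mem_of_dvd _ hdvd (Ideal.subset_span ⟨E, ?_, rfl⟩)
    refine (mem_dualFacetIdeal K).2 fun F hF => (prod_X_mem_varIdeal_iff K).2 ?_
    by_contra! hE
    have hzero : ∀ v, ∃ t : Fin (α v), v ∈ F → m ⟨v, t⟩ = 0 := by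
      intro v
      by_cases hv : v ∈ F
      · have hvE : v ∉ E := fun h => hE v h hv
        simpa [E, hv] using hvE
      · exact ⟨⟨0, hα v⟩, fun h => absurd h hv⟩
    choose s hs using hzero
    obtain ⟨p, hp, hmp⟩ := MvPolynomial.mem_ideal_span_X_image.1 (hf _ (hF.image_section s)) m hm
    obtain ⟨v, hv, rfl⟩ := Finset.mem_image.1 (Finset.mem_coe.1 hp)
    exact hmp (hs v hv)
  · refine Ideal.span_le.2 ?_
    rintro _ ⟨E, hE, rfl⟩
    refine (mem_dualFacetIdeal K).2 fun G hG => ?_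
    obtain ⟨v, hvE, hvG⟩ := (prod_X_mem_varIdeal_iff K).1
      ((mem_dualFacetIdeal K).1 hE _ (hG.image_fst hΔ hα))
    obtain ⟨⟨v, t⟩, hp, rfl⟩ := Finset.mem_image.1 hvG
    exact Ideal.mem_of_dvd _ ((Finset.dvd_prod_of_mem _ (Finset.mem_univ t)).trans
      (Finset.dvd_prod_of_mem _ hvE)) (X_mem_varIdeal K hp)
end

section
/- Let K be a field, α = (k_1,…,k_n) ∈ ℕ^n with all k_i ≥ 1, S = K[x_1,…,x_n], and S^α = K[x_{ij} : 1 ≤ i ≤ n, 1 ≤ j ≤ k_i]. Then the K-algebra homomorphism φ : S → S^α determined by φ(x_i) = ∏_{j=1}^{k_i} x_{ij} is injective, and S^α, viewed as an S-module via φ, is a flat S-module. -/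
/-- The exponent on `Σ i, κ i` that is constant, equal to `a i`, on the fiber over `i`. -/
noncomputable def fiberwiseConst {ι : Type*} {κ : ι → Type*} [Finite ι] [∀ i, Finite (κ i)]
    (a : ι →₀ ℕ) : ((i : ι) × κ i) →₀ ℕ :=
  Finsupp.equivFunOnFinite.symm fun p => a p.1

@[simp]
theorem fiberwiseConst_apply {ι : Type*} {κ : ι → Type*} [Finite ι] [∀ i, Finite (κ i)]
    (a : ι →₀ ℕ) (p : (i : ι) × κ i) : fiberwiseConst a p = a p.1 := rfl

/-- Exponents on `Σ i, κ i` that vanish somewhere on each fiber. -/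
abbrev ReducedExponent {ι : Type*} (κ : ι → Type*) : Type _ :=
  {b : ((i : ι) × κ i) →₀ ℕ // ∀ i, ∃ j, b ⟨i, j⟩ = 0}

/-- Every exponent is uniquely the sum of a reduced one and a fiberwise constant one. -/
theorem bijective_reducedExponent_add_fiberwiseConst {ι : Type*} {κ : ι → Type*} [Finite ι]
    [∀ i, Finite (κ i)] [∀ i, Nonempty (κ i)] :
    Function.Bijective fun p : (_ : ReducedExponent κ) × (ι →₀ ℕ) =>
      p.1.1 + fiberwiseConst p.2 := by
  constructor
  · rintro ⟨⟨b, hb⟩, a⟩ ⟨⟨b', hb'⟩, a'⟩ h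
    have key (i : ι) (j : κ i) : b ⟨i, j⟩ + a i = b' ⟨i, j⟩ + a' i := by
      simpa using DFunLike.congr_fun h ⟨i, j⟩
    obtain rfl : a = a' := by
      ext i
      obtain ⟨j, hj⟩ := hb i
      obtain ⟨j', hj'⟩ := hb' i
      have := key i j
      have := key i j'
      omega
    obtain rfl : b = b' := by
      ext ⟨i, j⟩
      exact Nat.add_right_cancel (key i j)
    rfl
  · intro m
    choose j hj using fun i => Finite.exists_min fun j : κ i => m ⟨i, j⟩
    let a : ι →₀ ℕ := Finsupp.equivFunOnFinite.symm fun i => m ⟨i, j i⟩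
    refine ⟨⟨⟨m - fiberwiseConst a, fun i => ⟨j i, ?_⟩⟩, a⟩, ?_⟩
    · simp [a]
    · ext ⟨i, k⟩
      simpa [a] using Nat.sub_add_cancel (hj i k)

namespace MvPolynomial

theorem algHom_monomial_of_forall_X_eq_prod {R ι : Type*} {κ : ι → Type*} [CommSemiring R]
    [Fintype ι] [∀ i, Fintype (κ i)] (φ : MvPolynomial ι R →ₐ[R] MvPolynomial ((i : ι) × κ i) R)
    (hφ : ∀ i, φ (X i) = ∏ j : κ i, X ⟨i, j⟩) (a : ι →₀ ℕ) :
    φ (monomial a 1) = monomial (fiberwiseConst a) 1 := by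
  rw [monomial_eq, monomial_eq, Finsupp.prod_fintype _ _ (by simp),
    Finsupp.prod_fintype _ _ (by simp), Fintype.prod_sigma]
  simp [map_prod, hφ, Finset.prod_pow]

/-- The reduced monomials form a basis of the expanded polynomial ring over the original one. -/
theorem bijective_lsum_mul_reducedMonomial {R ι : Type*} {κ : ι → Type*} [CommSemiring R]
    [Fintype ι] [∀ i, Fintype (κ i)] [∀ i, Nonempty (κ i)]
    (φ : MvPolynomial ι R →ₐ[R] MvPolynomial ((i : ι) × κ i) R)
    (hφ : ∀ i, φ (X i) = ∏ j : κ i, X ⟨i, j⟩) :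
    Function.Bijective (Finsupp.lsum R fun b : ReducedExponent κ =>
      (LinearMap.mulRight R (monomial b.1 1)).comp φ.toLinearMap) := by
  let e := (Finsupp.basis fun _ : ReducedExponent κ => basisMonomials ι R).equiv
    (basisMonomials ((i : ι) × κ i) R)
    (Equiv.ofBijective _ bijective_reducedExponent_add_fiberwiseConst)
  have h : (Finsupp.lsum R fun b : ReducedExponent κ =>
      (LinearMap.mulRight R (monomial b.1 1)).comp φ.toLinearMap) = e.toLinearMap := by
    refine (Finsupp.basis fun _ : ReducedExponent κ => basisMonomials ι R).ext fun p => ?_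
    rw [LinearEquiv.coe_coe, Module.Basis.equiv_apply]
    simp [algHom_monomial_of_forall_X_eq_prod φ hφ, monomial_mul, add_comm]
  rw [h]
  exact e.bijective

theorem injective_of_forall_X_eq_prod {R ι : Type*} {κ : ι → Type*} [CommSemiring R]
    [Fintype ι] [∀ i, Fintype (κ i)] [∀ i, Nonempty (κ i)]
    (φ : MvPolynomial ι R →ₐ[R] MvPolynomial ((i : ι) × κ i) R)
    (hφ : ∀ i, φ (X i) = ∏ j : κ i, X ⟨i, j⟩) : Function.Injective φ := by
  intro p q h
  let b : ReducedExponent κ := ⟨0, fun i => ⟨Classical.arbitrary _, rfl⟩⟩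
  apply Finsupp.single_injective b
  apply (bijective_lsum_mul_reducedMonomial φ hφ).injective
  simp [h]

theorem flat_of_forall_X_eq_prod {R ι : Type*} {κ : ι → Type*} [CommRing R]
    [Fintype ι] [∀ i, Fintype (κ i)] [∀ i, Nonempty (κ i)]
    (φ : MvPolynomial ι R →ₐ[R] MvPolynomial ((i : ι) × κ i) R)
    (hφ : ∀ i, φ (X i) = ∏ j : κ i, X ⟨i, j⟩) : φ.toRingHom.Flat := by
  algebraize [φ.toRingHom]
  let f := Finsupp.linearCombination (MvPolynomial ι R) fun b : ReducedExponent κ =>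
    (monomial b.1 1 : MvPolynomial ((i : ι) × κ i) R)
  have hf : ⇑f = Finsupp.lsum R fun b : ReducedExponent κ =>
      (LinearMap.mulRight R (monomial b.1 1)).comp φ.toLinearMap := by
    ext1 x
    simp only [f, Finsupp.linearCombination_apply, Finsupp.lsum_apply, Algebra.smul_def]
    rfl
  exact Module.Flat.of_linearEquiv
    (LinearEquiv.ofBijective f (hf ▸ bijective_lsum_mul_reducedMonomial φ hφ)).symm

end MvPolynomial


/-- the `K`-algebra map `φ : S → S^α`, `x_i ↦ ∏_{j=1}^{k_i} x_{ij}`, is injective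
and makes `S^α` a flat `S`-module. -/
theorem injective_and_flat_of_expansion_map (n : ℕ) (K : Type*) [Field K]
    (α : Fin n → ℕ) (hα : ∀ i, 1 ≤ α i)
    (φ : MvPolynomial (Fin n) K →ₐ[K] MvPolynomial ((i : Fin n) × Fin (α i)) K)
    (hφ : ∀ i : Fin n, φ (MvPolynomial.X i) =
      ∏ j : Fin (α i), MvPolynomial.X (⟨i, j⟩ : (i : Fin n) × Fin (α i))) :
    Function.Injective φ ∧ RingHom.Flat φ.toRingHom := by
  have (i : Fin n) : Nonempty (Fin (α i)) := ⟨⟨0, hα i⟩⟩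
  exact ⟨MvPolynomial.injective_of_forall_X_eq_prod φ hφ,
    MvPolynomial.flat_of_forall_X_eq_prod φ hφ⟩
end

section
/- Let Δ be a simplicial complex on X = {x_1,…,x_n} of dimension d, K a field, and let s ≥ 1 and α = (s,s,…,s) ∈ ℕ^n. If the facet ideal I(Δ) ⊆ S = K[x_1,…,x_n] has linear quotients, then the facet ideal I(Δ^α) ⊆ S^α satisfies pd(I(Δ^α)) ≤ pd(I(Δ))·s + (d+1)(s−1). -/
/-- The facet ideal `I(Δ) = (x^F : F ∈ 𝔉(Δ))` of a simplicial complex. -/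
noncomputable def facetIdeal (K : Type*) [Field K] {V : Type*} (Δ : Set (Finset V)) :
    Ideal (MvPolynomial V K) :=
  Ideal.span ((fun F => ∏ v ∈ F, MvPolynomial.X v) '' {F | IsFacet Δ F})

/-- The facet ideal of `Δ` has linear quotients: there is an ordering `f_1, …, f_m` of its
minimal monomial generators (the monomials `x^F` for the facets `F` of `Δ`) such that each
colon ideal `(f_1, …, f_{i-1}) : (f_i)` is generated by a subset of the variables. -/
def HasLinearQuotients (K : Type*) [Field K] {V : Type*} (Δ : Set (Finset V)) : Prop :=
  ∃ (m : ℕ) (f : Fin m → Finset V),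
    Function.Injective f ∧ Set.range f = {F | IsFacet Δ F} ∧
    ∀ i : Fin m, 0 < i.val →
      ∃ T : Set V,
        (Ideal.span ((fun F => (∏ v ∈ F, MvPolynomial.X v : MvPolynomial V K)) ''
            {F | ∃ j : Fin m, j < i ∧ f j = F})).colon
          (Ideal.span {(∏ v ∈ f i, MvPolynomial.X v : MvPolynomial V K)}) =
        Ideal.span (MvPolynomial.X '' T)

/-- `HasProjDimLE R n M` says that `M` admits a projective resolution of length at most `n`. -/
def HasProjDimLE (R : Type) [CommRing R] : ℕ → ∀ (M : Type) [AddCommGroup M] [Module R M], Prop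
  | 0, M, _, _ => Module.Projective R M
  | n + 1, M, _, _ => ∃ (P : Type) (_ : AddCommGroup P) (_ : Module R P) (f : P →ₗ[R] M),
      Module.Projective R P ∧ Function.Surjective f ∧ HasProjDimLE R n (LinearMap.ker f)

/-- The projective dimension of a module: the length of a shortest projective resolution
(`⊤` if there is no finite projective resolution). -/
noncomputable def projDim (R : Type) [CommRing R] (M : Type) [AddCommGroup M] [Module R M] :
    ℕ∞ :=
  sInf {n : ℕ∞ | ∃ k : ℕ, (k : ℕ∞) = n ∧ HasProjDimLE R k M}
namespace Koszul

/-- The sign `(-1)^k`, where `k` is the number of elements of `τ` below `u`. -/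
def sign {V : Type*} [LinearOrder V] (u : V) (τ : Finset V) : ℤ :=
  (-1) ^ (τ.filter (· < u)).card

theorem sign_mul_self {V : Type*} [LinearOrder V] (u : V) (τ : Finset V) :
    sign u τ * sign u τ = 1 := by
  simp only [sign, ← mul_pow, neg_mul_neg, one_mul, one_pow]

theorem sign_insert_of_lt {V : Type*} [LinearOrder V] {u v : V} {τ : Finset V} (h : u < v) :
    sign u (insert v τ) = sign u τ := by
  simp [sign, Finset.filter_insert, h.not_gt]

theorem sign_insert_of_gt {V : Type*} [LinearOrder V] {u v : V} {τ : Finset V} (h : u < v)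
    (hu : u ∉ τ) : sign v (insert u τ) = -sign v τ := by
  simp [sign, Finset.filter_insert, h, hu, pow_succ]

theorem sign_mul_sign_insert {V : Type*} [LinearOrder V] {u v : V} {τ : Finset V} (h : u ≠ v)
    (hu : u ∉ τ) (hv : v ∉ τ) :
    sign u τ * sign v (insert u τ) = -(sign v τ * sign u (insert v τ)) := by
  rcases h.lt_or_gt with h | h
  · rw [sign_insert_of_lt h, sign_insert_of_gt h hu]; ring
  · rw [sign_insert_of_lt h, sign_insert_of_gt h hv]; ring

theorem sign_insert_mul_sign_insert {V : Type*} [LinearOrder V] {u v : V} {τ : Finset V}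
    (h : u ≠ v) (hu : u ∉ τ) (hv : v ∉ τ) :
    sign v (insert u τ) * sign u (insert v τ) = -(sign u τ * sign v τ) := by
  rcases h.lt_or_gt with h | h
  · rw [sign_insert_of_lt h, sign_insert_of_gt h hu]; ring
  · rw [sign_insert_of_lt h, sign_insert_of_gt h hv]; ring

variable {V R M : Type*} [LinearOrder V] [Fintype V] [CommRing R] [AddCommGroup M] [Module R M]

/-- The differential of the Koszul complex of the family `x` with coefficients in `M`; a chain
(of mixed homological degree) is a function `Finset V → M`. -/
def boundary (x : V → R) : (Finset V → M) →ₗ[R] (Finset V → M) where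
  toFun z τ := ∑ u ∈ τᶜ, sign u τ • x u • z (insert u τ)
  map_add' z w := by ext τ; simp [Finset.sum_add_distrib]
  map_smul' r z := by
    ext τ
    simp only [Pi.smul_apply, RingHom.id_apply, Finset.smul_sum]
    refine Finset.sum_congr rfl fun u _ => ?_
    rw [smul_comm r (sign u τ), smul_comm r (x u)]

theorem boundary_apply (x : V → R) (z : Finset V → M) (τ : Finset V) :
    boundary x z τ = ∑ u ∈ τᶜ, sign u τ • x u • z (insert u τ) := rfl

theorem boundary_comp {M' : Type*} [AddCommGroup M'] [Module R M'] (x : V → R) (f : M →ₗ[R] M')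
    (z : Finset V → M) : boundary x (f ∘ z) = f ∘ boundary x z := by
  ext τ; simp [boundary_apply]

theorem boundary_mem (x : V → R) (N : Submodule R M) {z : Finset V → M} (hz : ∀ τ, z τ ∈ N)
    (τ : Finset V) : boundary x z τ ∈ N :=
  N.sum_mem fun _ _ => zsmul_mem (N.smul_mem _ (hz _)) _

theorem boundary_boundary (x : V → R) (z : Finset V → M) : boundary x (boundary x z) = 0 := by
  ext τ
  simp only [boundary_apply, Finset.smul_sum, Pi.zero_apply]
  rw [Finset.sum_sigma']
  refine Finset.sum_involution (fun p _ => ⟨p.2, p.1⟩) ?_ ?_ ?_ ?_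
  · rintro ⟨u, v⟩ h
    simp only [Finset.mem_sigma, Finset.mem_compl, Finset.mem_insert, not_or] at h
    obtain ⟨hu, hvu, hv⟩ := h
    dsimp only
    rw [Finset.insert_comm u v, smul_comm (x u) (sign v _), smul_comm (x v) (sign u _),
      smul_smul (sign u τ), smul_smul (sign v τ),
      sign_mul_sign_insert (Ne.symm hvu) hu hv, neg_smul, smul_comm (x v) (x u), neg_add_cancel]
  · rintro ⟨u, v⟩ h _ heq
    simp only [Finset.mem_sigma, Finset.mem_compl, Finset.mem_insert, not_or] at h
    simp only [Sigma.mk.injEq, heq_eq_eq] at heq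
    exact h.2.1 heq.1
  · rintro ⟨u, v⟩ h
    simp only [Finset.mem_sigma, Finset.mem_compl, Finset.mem_insert, not_or] at h ⊢
    exact ⟨h.2.2, Ne.symm h.2.1, h.1⟩
  · intros; rfl

/-- The part of a chain in homological degrees larger than `p`. -/
def truncate (p : ℕ) (z : Finset V → M) (τ : Finset V) : M := if τ.card ≤ p then 0 else z τ

theorem boundary_truncate (x : V → R) {p : ℕ} {z : Finset V → M}
    (hz : ∀ τ : Finset V, τ.card < p → boundary x z τ = 0) :
    boundary x (truncate p z) = boundary x z := by
  ext τ
  by_cases hτ : τ.card < p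
  · rw [hz τ hτ, boundary_apply]
    refine Finset.sum_eq_zero fun u hu => ?_
    rw [truncate, if_pos ((Finset.card_insert_le _ _).trans hτ), smul_zero, smul_zero]
  · rw [boundary_apply, boundary_apply]
    refine Finset.sum_congr rfl fun u hu => ?_
    rw [truncate, if_neg]
    rw [Finset.card_insert_of_notMem (Finset.mem_compl.1 hu)]
    omega

/-- The operator on chains induced by an operator `D` on `M` that divides by the variable `u`. -/
def homotopy (D : M →+ M) (u : V) (z : Finset V → M) (τ : Finset V) : M :=
  if u ∈ τ then sign u (τ.erase u) • D (z (τ.erase u)) else 0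

theorem boundary_homotopy_add (x : V → R) (D : M →+ M) (u : V)
    (hself : ∀ m, D (x u • m) = m) (hne : ∀ v, v ≠ u → ∀ m, D (x v • m) = x v • D m)
    (z : Finset V → M) (τ : Finset V) :
    boundary x (homotopy D u z) τ + homotopy D u (boundary x z) τ =
      if u ∈ τ then z τ else x u • D (z τ) := by
  by_cases hu : u ∈ τ
  · obtain ⟨σ, hσ, rfl⟩ : ∃ σ, u ∉ σ ∧ insert u σ = τ :=
      ⟨τ.erase u, Finset.notMem_erase _ _, Finset.insert_erase hu⟩
    have h1 : boundary x (homotopy D u z) (insert u σ) =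
        ∑ v ∈ (insert u σ)ᶜ, (sign v (insert u σ) * sign u (insert v σ)) •
          x v • D (z (insert v σ)) := by
      refine Finset.sum_congr rfl fun v hv => ?_
      simp only [Finset.mem_compl, Finset.mem_insert, not_or] at hv
      have : (insert v (insert u σ)).erase u = insert v σ := by
        rw [Finset.insert_comm, Finset.erase_insert]
        simp [hσ, Ne.symm hv.1]
      rw [homotopy, if_pos (by simp), this, smul_comm (x v), smul_smul]
    have h2 : homotopy D u (boundary x z) (insert u σ) =
        ∑ v ∈ σᶜ, (sign u σ * sign v σ) • D (x v • z (insert v σ)) := by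
      rw [homotopy, if_pos (by simp), Finset.erase_insert hσ, boundary_apply, map_sum,
        Finset.smul_sum]
      simp only [map_zsmul, smul_smul]
    have h3 : σᶜ = insert u (insert u σ)ᶜ := by
      ext v; by_cases h : v = u <;> simp [h, hσ]
    rw [h1, h2, h3, Finset.sum_insert (by simp), sign_mul_self, one_smul, hself, if_pos (by simp),
      add_left_comm, ← Finset.sum_add_distrib, Finset.sum_eq_zero, add_zero]
    intro v hv
    simp only [Finset.mem_compl, Finset.mem_insert, not_or] at hv
    rw [hne v hv.1, sign_insert_mul_sign_insert (Ne.symm hv.1) hσ hv.2, neg_smul, neg_add_cancel]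
  · rw [homotopy, if_neg hu, if_neg hu, add_zero, boundary_apply,
      Finset.sum_eq_single_of_mem u (by simpa using hu)]
    · rw [homotopy, if_pos (by simp), Finset.erase_insert hu, smul_comm (x u), smul_smul,
        sign_mul_self, one_smul]
    · intro v _ hv
      rw [homotopy, if_neg (by simp [hu, Ne.symm hv]), smul_zero, smul_zero]

theorem exists_boundary_sub (x : V → R) (D : V → M →+ M)
    (hself : ∀ u m, D u (x u • m) = m)
    (hne : ∀ u v, v ≠ u → ∀ m, D u (x v • m) = x v • D u m)
    (hcomm : ∀ u v m, D u (D v m) = D v (D u m))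
    (N : Submodule R M) (H : AddSubgroup M) (hH : ∀ u v, ∀ m ∈ H, x v • D u m ∈ H)
    (U : Finset V) (hN : ∀ u ∈ U, ∀ m ∈ N, D u m ∈ N)
    (w : Finset V → M) (hwH : ∀ τ, w τ ∈ H) (hw : ∀ τ, boundary x w τ ∈ N) :
    ∃ y : Finset V → M, (∀ τ, (w - boundary x y) τ ∈ H) ∧
      ∀ τ, (¬ Disjoint τ U → (w - boundary x y) τ ∈ N) ∧
        ∀ u ∈ U, D u ((w - boundary x y) τ) ∈ N := by
  induction U using Finset.induction_on with
  | empty => exact ⟨0, by simpa using hwH, by simp⟩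
  | insert u U hu ih =>
    obtain ⟨y, hyH, hy⟩ := ih fun v hv => hN v (Finset.mem_insert_of_mem hv)
    set r := w - boundary x y with hr
    have hr' : boundary x r = boundary x w := by rw [hr, map_sub, boundary_boundary, sub_zero]
    have hDu := hN u (Finset.mem_insert_self _ _)
    have key : ∀ τ, ∃ n ∈ N, (w - boundary x (y + homotopy (D u) u r)) τ =
        (if u ∈ τ then 0 else r τ - x u • D u (r τ)) + n := by
      intro τ
      refine ⟨homotopy (D u) u (boundary x r) τ, ?_, ?_⟩
      · rw [homotopy]
        split_ifs
        · exact zsmul_mem (hDu _ (by rw [hr']; exact hw _)) _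
        · exact N.zero_mem
      · have h := boundary_homotopy_add x (D u) u (hself u) (hne u) r τ
        rw [map_add, ← sub_sub, ← hr, Pi.sub_apply, eq_sub_of_add_eq h]
        split_ifs <;> abel
    refine ⟨y + homotopy (D u) u r, fun τ => ?_, fun τ => ⟨fun hτ => ?_, fun v hv => ?_⟩⟩
    · rw [map_add, ← sub_sub, ← hr, Pi.sub_apply, boundary_apply]
      refine H.sub_mem (hyH τ) (H.sum_mem fun v _ => zsmul_mem ?_ _)
      rw [homotopy]
      split_ifs
      · rw [smul_comm]; exact zsmul_mem (hH _ _ _ (hyH _)) _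
      · rw [smul_zero]; exact H.zero_mem
    · obtain ⟨n, hn, h⟩ := key τ
      rw [h]
      refine N.add_mem ?_ hn
      split_ifs with huτ
      · exact N.zero_mem
      · have := (hy τ).1 (by simpa [Finset.disjoint_insert_right, huτ] using hτ)
        exact N.sub_mem this (N.smul_mem _ (hDu _ this))
    · obtain ⟨n, hn, h⟩ := key τ
      rw [h, map_add]
      refine N.add_mem ?_ (hN v hv _ hn)
      split_ifs with huτ
      · rw [map_zero]; exact N.zero_mem
      · rw [map_sub]
        by_cases hvu : v = u
        · rw [hvu, hself, sub_self]; exact N.zero_mem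
        · have := (hy τ).2 v (Finset.mem_of_mem_insert_of_ne hv hvu)
          rw [hne v u (Ne.symm hvu), hcomm]
          exact N.sub_mem this (N.smul_mem _ (hDu _ this))

theorem exists_boundary_eq (x : V → R) (D : V → M →+ M)
    (hself : ∀ u m, D u (x u • m) = m)
    (hne : ∀ u v, v ≠ u → ∀ m, D u (x v • m) = x v • D u m)
    (hcomm : ∀ u v m, D u (D v m) = D v (D u m))
    {z : Finset V → M} (hz : boundary x z = 0) (h0 : z ∅ = 0) : ∃ y, boundary x y = z := by
  obtain ⟨y, -, hy⟩ := exists_boundary_sub x D hself hne hcomm ⊥ ⊤ (by simp) Finset.univ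
    (by simp) z (by simp) (by simp [hz])
  refine ⟨truncate 1 y, ?_⟩
  ext τ
  rcases τ.eq_empty_or_nonempty with rfl | hτ
  · rw [h0, boundary_apply]
    refine Finset.sum_eq_zero fun u _ => ?_
    simp [truncate]
  · have := (hy τ).1 fun h => hτ.ne_empty (by simpa using h.mono_right (Finset.subset_univ τ))
    rw [Submodule.mem_bot, Pi.sub_apply, sub_eq_zero] at this
    rw [this]
    refine Finset.sum_congr rfl fun u hu => ?_
    rw [truncate, if_neg]
    rw [Finset.card_insert_of_notMem (Finset.mem_compl.1 hu)]
    have := hτ.card_pos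
    omega

end Koszul

namespace HasProjDimLE

variable {R : Type} [CommRing R]

theorem of_equiv {n : ℕ} {M N : Type} [AddCommGroup M] [Module R M] [AddCommGroup N] [Module R N]
    (e : M ≃ₗ[R] N) (h : HasProjDimLE R n M) : HasProjDimLE R n N := by
  cases n with
  | zero =>
    have : Module.Projective R M := h
    exact Module.Projective.of_equiv e
  | succ n =>
    obtain ⟨P, _, _, f, hP, hf, hk⟩ := h
    refine ⟨P, _, _, e.toLinearMap ∘ₗ f, hP, e.surjective.comp hf, ?_⟩
    rwa [LinearEquiv.ker_comp]

theorem succ {n : ℕ} {M : Type} [AddCommGroup M] [Module R M] (h : HasProjDimLE R n M) :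
    HasProjDimLE R (n + 1) M := by
  induction n generalizing M with
  | zero =>
    refine ⟨M, _, _, LinearMap.id, h, Function.surjective_id, ?_⟩
    rw [LinearMap.ker_id]
    exact (inferInstance : Module.Projective R (⊥ : Submodule R M))
  | succ n ih =>
    obtain ⟨P, _, _, f, hP, hf, hk⟩ := h
    exact ⟨P, _, _, f, hP, hf, ih hk⟩

theorem mono {m n : ℕ} (hmn : m ≤ n) {M : Type} [AddCommGroup M] [Module R M]
    (h : HasProjDimLE R m M) : HasProjDimLE R n M := by
  induction n, hmn using Nat.le_induction with
  | base => exact h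
  | succ n _ ih => exact ih.succ

theorem of_projective (n : ℕ) (M : Type) [AddCommGroup M] [Module R M] [h : Module.Projective R M] :
    HasProjDimLE R n M :=
  mono (Nat.zero_le n) h

/-- The projective dimension of an extension. -/
theorem extension {n : ℕ} {A B C : Type} [AddCommGroup A] [Module R A] [AddCommGroup B]
    [Module R B] [AddCommGroup C] [Module R C] (f : A →ₗ[R] B) (g : B →ₗ[R] C)
    (hf : Function.Injective f) (hg : Function.Surjective g) (hfg : Function.Exact f g)
    (hA : HasProjDimLE R n A) (hC : HasProjDimLE R n C) : HasProjDimLE R n B := by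
  induction n generalizing A B C with
  | zero =>
    have : Module.Projective R A := hA
    have : Module.Projective R C := hC
    obtain ⟨l, hl⟩ := Module.projective_lifting_property g LinearMap.id hg
    exact Module.Projective.of_equiv
      (hfg.splitSurjectiveEquiv hf ⟨l, hl⟩).1.symm
  | succ n ih =>
    obtain ⟨P, _, _, a, hP, ha, hka⟩ := hA
    obtain ⟨Q, _, _, c, hQ, hc, hkc⟩ := hC
    obtain ⟨l, hl⟩ := Module.projective_lifting_property g c hg
    have hl' : ∀ q, g (l q) = c q := fun q => LinearMap.congr_fun hl q
    have hgf : ∀ p, g (f p) = 0 := hfg.apply_apply_eq_zero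
    refine ⟨P × Q, _, _, (f ∘ₗ a).coprod l, inferInstance, fun b => ?_, ?_⟩
    · obtain ⟨q, hq⟩ := hc (g b)
      obtain ⟨y, hy⟩ := (hfg (b - l q)).1 (by rw [map_sub, hl', hq, sub_self])
      obtain ⟨p, rfl⟩ := ha y
      exact ⟨(p, q), by simp [hy]⟩
    · have hker : ∀ p q, (p, q) ∈ LinearMap.ker ((f ∘ₗ a).coprod l) ↔ f (a p) + l q = 0 := by
        simp
      refine ih
        ((LinearMap.inl R P Q).restrict (p := LinearMap.ker a) fun p hp => ?_)
        ((LinearMap.snd R P Q).restrict (q := LinearMap.ker c) fun p hp => ?_) ?_ ?_ ?_ hka hkc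
      · rw [LinearMap.inl_apply, hker, LinearMap.mem_ker.1 hp, map_zero, map_zero, add_zero]
      · obtain ⟨p, q⟩ := p
        have := congr_arg g ((hker p q).1 hp)
        rwa [map_add, hgf, hl', zero_add, map_zero] at this
      · intro p q h
        exact Subtype.ext (congr_arg (fun k => k.1.1) h)
      · rintro ⟨q, hq⟩
        obtain ⟨y, hy⟩ := (hfg (l q)).1 (by rw [hl']; exact hq)
        obtain ⟨p, rfl⟩ := ha y
        exact ⟨⟨(-p, q), by rw [hker]; simp [hy]⟩, rfl⟩
      · rintro ⟨⟨p, q⟩, hpq⟩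
        rw [hker] at hpq
        constructor
        · intro h
          obtain rfl : q = 0 := congr_arg Subtype.val h
          have : a p = 0 := hf (by simpa using hpq)
          exact ⟨⟨p, this⟩, rfl⟩
        · rintro ⟨p', h⟩
          have : (p'.1, (0 : Q)) = (p, q) := congr_arg Subtype.val h
          exact Subtype.ext (congr_arg Prod.snd this).symm

/-- The projective dimension of a cokernel. -/
theorem cokernel {n : ℕ} {A B C : Type} [AddCommGroup A] [Module R A] [AddCommGroup B]
    [Module R B] [AddCommGroup C] [Module R C] (f : A →ₗ[R] B) (g : B →ₗ[R] C)
    (hf : Function.Injective f) (hg : Function.Surjective g) (hfg : Function.Exact f g)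
    (hA : HasProjDimLE R n A) (hB : HasProjDimLE R n B) : HasProjDimLE R (n + 1) C := by
  obtain ⟨P, _, _, b, hP, hb, hkb⟩ := hB.succ
  refine ⟨P, _, _, g ∘ₗ b, hP, hg.comp hb, ?_⟩
  have hle : LinearMap.ker b ≤ LinearMap.ker (g ∘ₗ b) := LinearMap.ker_le_ker_comp b g
  let e : A ≃ₗ[R] LinearMap.range f := LinearEquiv.ofInjective f hf
  have hr : ∀ p ∈ LinearMap.ker (g ∘ₗ b), b p ∈ LinearMap.range f := fun p hp => (hfg _).1 hp
  refine extension (Submodule.inclusion hle) (b.restrict hr) (Submodule.inclusion_injective hle)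
    ?_ ?_ hkb (hA.of_equiv e)
  · rintro ⟨_, y, rfl⟩
    obtain ⟨p, hp⟩ := hb (f y)
    exact ⟨⟨p, by simp [hp, hfg.apply_apply_eq_zero]⟩, Subtype.ext hp⟩
  · rintro ⟨p, hp⟩
    constructor
    · intro h
      exact ⟨⟨p, congr_arg Subtype.val h⟩, rfl⟩
    · rintro ⟨⟨q, hq⟩, h⟩
      obtain rfl : q = p := congr_arg Subtype.val h
      exact Subtype.ext hq

open Koszul in
/-- Koszul homology vanishes above the projective dimension. -/
theorem exists_boundary_eq {V : Type*} [LinearOrder V] [Fintype V] (x : V → R) (D : V → R →+ R)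
    (hself : ∀ u m, D u (x u • m) = m)
    (hne : ∀ u v, v ≠ u → ∀ m, D u (x v • m) = x v • D u m)
    (hcomm : ∀ u v m, D u (D v m) = D v (D u m))
    {p : ℕ} {M : Type} [AddCommGroup M] [Module R M] (hM : HasProjDimLE R p M)
    {z : Finset V → M} (hz : boundary x z = 0) (h0 : ∀ τ : Finset V, τ.card ≤ p → z τ = 0) :
    ∃ y, boundary x y = z := by
  have proj : ∀ {P : Type} [AddCommGroup P] [Module R P] [Module.Projective R P]
      {z : Finset V → P}, boundary x z = 0 → z ∅ = 0 → ∃ y, boundary x y = z := by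
    intro P _ _ _ z hz h0
    obtain ⟨s, hs⟩ := (Module.projective_def' (R := R) (P := P)).1 inferInstance
    obtain ⟨y, hy⟩ := Koszul.exists_boundary_eq (M := P →₀ R) x
      (fun u => Finsupp.mapRange.addMonoidHom (D u))
      (fun u m => by ext a; exact hself u (m a))
      (fun u v h m => by ext a; exact hne u v h (m a))
      (fun u v m => by ext; simp [hcomm u v])
      (z := s ∘ z) (by rw [boundary_comp, hz]; ext; simp) (by simp [h0])
    refine ⟨Finsupp.linearCombination R id ∘ y, ?_⟩
    rw [boundary_comp, hy]
    ext τ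
    exact LinearMap.congr_fun hs (z τ)
  induction p generalizing M with
  | zero =>
    have : Module.Projective R M := hM
    exact proj hz (h0 ∅ le_rfl)
  | succ p ih =>
    obtain ⟨P, _, _, f, hP, hf, hk⟩ := hM
    obtain ⟨w, hw, hw0⟩ : ∃ w : Finset V → P, f ∘ w = z ∧ ∀ τ, τ.card ≤ p + 1 → w τ = 0 := by
      choose g hg using hf
      refine ⟨fun τ => if τ.card ≤ p + 1 then 0 else g (z τ), ?_, fun τ hτ => if_pos hτ⟩
      ext τ
      by_cases h : τ.card ≤ p + 1 <;> simp [h, hg, h0]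
    have hwk : ∀ τ, boundary x w τ ∈ LinearMap.ker f := fun τ => by
      rw [LinearMap.mem_ker, ← Function.comp_apply (f := f), ← boundary_comp, hw, hz]; rfl
    have hlow : ∀ τ : Finset V, τ.card < p + 1 → boundary x w τ = 0 := fun τ hτ => by
      rw [boundary_apply]
      refine Finset.sum_eq_zero fun u _ => ?_
      rw [hw0 _ ((Finset.card_insert_le _ _).trans hτ), smul_zero, smul_zero]
    have hsub : (LinearMap.ker f).subtype ∘ (fun τ => ⟨boundary x w τ, hwk τ⟩) = boundary x w := rfl
    obtain ⟨y, hy⟩ := ih hk (z := fun τ => ⟨boundary x w τ, hwk τ⟩)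
      (by
        ext τ
        have := congr_fun (boundary_comp x (LinearMap.ker f).subtype
          (fun τ => ⟨boundary x w τ, hwk τ⟩)) τ
        rw [hsub, boundary_boundary] at this
        exact this.symm)
      (fun τ hτ => Subtype.ext (hlow τ (by omega)))
    set y' : Finset V → P := (LinearMap.ker f).subtype ∘ y with hy'
    have hby : boundary x y' = boundary x w := by rw [hy', boundary_comp, hy, hsub]
    have ht := boundary_truncate x (p := p + 1) (z := y') (by rwa [hby])
    obtain ⟨c, hc⟩ := proj (z := w - truncate (p + 1) y')
      (by rw [map_sub, ht, hby, sub_self])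
      (by rw [Pi.sub_apply, hw0 ∅ (by simp), truncate, if_pos (by simp), sub_zero])
    refine ⟨f ∘ c, ?_⟩
    rw [boundary_comp, hc, ← hw]
    ext τ
    have : f (y' τ) = 0 := (y τ).2
    simp only [Function.comp_apply, Pi.sub_apply, map_sub, truncate]
    split_ifs <;> simp [this]

end HasProjDimLE

/-- The ideal generated by the squarefree monomials `x^F` with `F ∈ 𝒢`. -/
noncomputable def squarefreeIdeal (K : Type*) [Field K] {V : Type*} (𝒢 : Set (Finset V)) :
    Ideal (MvPolynomial V K) :=
  Ideal.span ((fun F => ∏ v ∈ F, MvPolynomial.X v) '' 𝒢)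

namespace squarefreeIdeal

open MvPolynomial

variable {K : Type*} [Field K] {V : Type*}

/-- The exponent of the monomial `x^F`. -/
noncomputable def exponent (F : Finset V) : V →₀ ℕ := ∑ v ∈ F, Finsupp.single v 1

theorem exponent_apply [DecidableEq V] (F : Finset V) (v : V) :
    exponent F v = if v ∈ F then 1 else 0 := by
  simp [exponent, Finsupp.finsetSum_apply, Finsupp.single_apply]

theorem exponent_le_iff {F : Finset V} {a : V →₀ ℕ} : exponent F ≤ a ↔ F ⊆ a.support := by
  classical
  rw [Finsupp.le_def]
  simp only [exponent_apply, Finset.subset_iff, Finsupp.mem_support_iff]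
  refine forall_congr' fun v => ?_
  split_ifs with h <;> simp [h, Nat.one_le_iff_ne_zero]

theorem prod_X_eq (F : Finset V) :
    (∏ v ∈ F, X v : MvPolynomial V K) = monomial (exponent F) 1 := by
  rw [exponent, monomial_sum_one]; rfl

theorem mem_iff {𝒢 : Set (Finset V)} {p : MvPolynomial V K} :
    p ∈ squarefreeIdeal K 𝒢 ↔ ∀ a ∈ p.support, ∃ F ∈ 𝒢, F ⊆ a.support := by
  have : squarefreeIdeal K 𝒢 =
      Ideal.span ((fun a => monomial a (1 : K)) '' (exponent '' 𝒢)) := by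
    rw [squarefreeIdeal, Set.image_image]
    simp only [prod_X_eq]
  rw [this, mem_ideal_span_monomial_image]
  simp [exponent_le_iff]

theorem prod_X_mem {𝒢 : Set (Finset V)} {F : Finset V} (hF : F ∈ 𝒢) :
    (∏ v ∈ F, X v : MvPolynomial V K) ∈ squarefreeIdeal K 𝒢 :=
  Ideal.subset_span ⟨F, hF, rfl⟩

theorem mono {𝒢 ℋ : Set (Finset V)} (h : 𝒢 ⊆ ℋ) : squarefreeIdeal K 𝒢 ≤ squarefreeIdeal K ℋ :=
  Ideal.span_mono (Set.image_mono h)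

theorem X_mul_prod_X_mem_iff [DecidableEq V] {𝒢 : Set (Finset V)} {F : Finset V} {v : V} :
    X v * ∏ w ∈ F, X w ∈ squarefreeIdeal K 𝒢 ↔ ∃ G ∈ 𝒢, G ⊆ insert v F := by
  have h : (Finsupp.single v 1 + exponent F).support = insert v F := by
    ext w
    simp only [Finsupp.mem_support_iff, Finsupp.add_apply, exponent_apply, Finsupp.single_apply,
      Finset.mem_insert, eq_comm (a := v)]
    split_ifs <;> simp_all
  rw [mem_iff, prod_X_eq, X, monomial_mul, one_mul]
  classical
  rw [support_monomial, if_neg one_ne_zero]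
  simp [h]

/-- Division by the variable `u`, discarding the monomials not divisible by it. -/
noncomputable def divX (u : V) : MvPolynomial V K →+ MvPolynomial V K where
  toFun p := p.divMonomial (Finsupp.single u 1)
  map_zero' := zero_divMonomial _
  map_add' p q := add_divMonomial p q _

theorem coeff_divX (u : V) (p : MvPolynomial V K) (a : V →₀ ℕ) :
    coeff a (divX u p) = coeff (Finsupp.single u 1 + a) p := coeff_divMonomial _ _ _

theorem divX_X_smul_self (u : V) (p : MvPolynomial V K) :
    divX u ((X u : MvPolynomial V K) • p) = p :=
  X_mul_divMonomial u p

theorem divX_X_smul_of_ne [DecidableEq V] (u v : V) (h : v ≠ u) (p : MvPolynomial V K) :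
    divX u ((X v : MvPolynomial V K) • p) = (X v : MvPolynomial V K) • divX u p := by
  ext a
  have h1 : Finsupp.single u 1 + a - Finsupp.single v 1 =
      Finsupp.single u 1 + (a - Finsupp.single v 1) := by
    ext w
    simp only [Finsupp.tsub_apply, Finsupp.add_apply, Finsupp.single_apply]
    split_ifs with h2 h3
    · exact absurd (h3.trans h2.symm) h
    all_goals omega
  have h2 : v ∈ (Finsupp.single u 1 + a).support ↔ v ∈ a.support := by
    simp [h.symm]
  rw [smul_eq_mul, smul_eq_mul, coeff_divX, coeff_X_mul', coeff_X_mul', coeff_divX, h1]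
  simp only [h2]

theorem divX_comm (u v : V) (p : MvPolynomial V K) : divX u (divX v p) = divX v (divX u p) := by
  ext a
  rw [coeff_divX, coeff_divX, coeff_divX, coeff_divX, add_left_comm]

theorem isHomogeneous_X_smul_divX [DecidableEq V] {e : ℕ} (u v : V) {p : MvPolynomial V K}
    (hp : p.IsHomogeneous e) : ((X v : MvPolynomial V K) • divX u p).IsHomogeneous e := by
  intro a ha
  rw [smul_eq_mul, coeff_X_mul'] at ha
  split_ifs at ha with hv
  · rw [coeff_divX] at ha
    have h := hp ha
    have h' : a = a - Finsupp.single v 1 + Finsupp.single v 1 := by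
      rw [tsub_add_cancel_of_le]
      simpa [Nat.one_le_iff_ne_zero] using hv
    rw [h', ← h, add_comm, map_add, map_add, Finsupp.weight_single,
      Finsupp.weight_single]
    rfl
  · exact absurd rfl ha

theorem isHomogeneous_prod_X (F : Finset V) :
    (∏ v ∈ F, X v : MvPolynomial V K).IsHomogeneous F.card := by
  simpa using IsHomogeneous.prod F (fun v => (X v : MvPolynomial V K)) (fun _ => 1)
    fun v _ => isHomogeneous_X K v

theorem divX_mem_span_X {T : Set V} {u : V} (hu : u ∉ T) {p : MvPolynomial V K}
    (hp : p ∈ Ideal.span (X '' T : Set (MvPolynomial V K))) :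
    divX u p ∈ Ideal.span (X '' T : Set (MvPolynomial V K)) := by
  rw [mem_ideal_span_X_image] at hp ⊢
  intro a ha
  rw [mem_support_iff, coeff_divX] at ha
  obtain ⟨v, hv, h⟩ := hp _ (mem_support_iff.2 ha)
  refine ⟨v, hv, ?_⟩
  classical
  have : u ≠ v := fun h => hu (h ▸ hv)
  simpa [Finsupp.single_apply, this] using h

theorem mem_span_X_of_divX_mem {T : Set V} {e : ℕ} (he : e ≠ 0) {p : MvPolynomial V K}
    (hp : p.IsHomogeneous e)
    (h : ∀ u ∉ T, divX u p ∈ Ideal.span (X '' T : Set (MvPolynomial V K))) :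
    p ∈ Ideal.span (X '' T : Set (MvPolynomial V K)) := by
  rw [mem_ideal_span_X_image]
  intro a ha
  obtain ⟨v, hv⟩ : ∃ v, a v ≠ 0 := by
    by_contra! h0
    obtain rfl : a = 0 := Finsupp.ext h0
    exact he (by simpa using (hp (mem_support_iff.1 ha)).symm)
  by_cases hvT : v ∈ T
  · exact ⟨v, hvT, hv⟩
  · have h' : Finsupp.single v 1 + (a - Finsupp.single v 1) = a := by
      rw [add_tsub_cancel_of_le]
      simpa [Nat.one_le_iff_ne_zero] using hv
    obtain ⟨w, hw, h⟩ := mem_ideal_span_X_image.1 (h v hvT) (a - Finsupp.single v 1)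
      (by rw [mem_support_iff, coeff_divX, h']; exact mem_support_iff.1 ha)
    exact ⟨w, hw, fun h0 => h (by rw [Finsupp.tsub_apply, h0, zero_tsub])⟩

end squarefreeIdeal

/-- The family `𝒢`, ordered by `key`, has linear quotients, with the colon ideal at `F ∈ 𝒢`
generated by the variables in `T F`. -/
structure IsLinearQuotientOrder {V ι : Type*} [DecidableEq V] [LinearOrder ι]
    (𝒢 : Finset (Finset V)) (key : Finset V → ι) (T : Finset V → Finset V) : Prop where
  disjoint : ∀ F ∈ 𝒢, Disjoint (T F) F
  meets : ∀ F ∈ 𝒢, ∀ G ∈ 𝒢, G ≠ F → key G ≤ key F → ∃ v ∈ T F, v ∈ G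
  attach : ∀ F ∈ 𝒢, ∀ v ∈ T F, ∃ G ∈ 𝒢, key G < key F ∧ G ⊆ insert v F

namespace IsLinearQuotientOrder

open MvPolynomial squarefreeIdeal

section

variable {V ι : Type*} [DecidableEq V] [LinearOrder ι] {𝒢 : Finset (Finset V)}
  {key : Finset V → ι} {T : Finset V → Finset V}

theorem of_subset (h : IsLinearQuotientOrder 𝒢 key T) {ℋ : Finset (Finset V)} (hℋ : ℋ ⊆ 𝒢)
    (hlow : ∀ F ∈ ℋ, ∀ G ∈ 𝒢, key G < key F → G ∈ ℋ) : IsLinearQuotientOrder ℋ key T where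
  disjoint F hF := h.disjoint F (hℋ hF)
  meets F hF G hG := h.meets F (hℋ hF) G (hℋ hG)
  attach F hF v hv := by
    obtain ⟨G, hG, hlt, hsub⟩ := h.attach F (hℋ hF) v hv
    exact ⟨G, hlow F hF G hG hlt, hlt, hsub⟩

theorem of_insert {F : Finset V} {ℋ : Finset (Finset V)}
    (h : IsLinearQuotientOrder (insert F ℋ) key T) (hmax : ∀ G ∈ ℋ, key G ≤ key F) :
    IsLinearQuotientOrder ℋ key T :=
  h.of_subset (Finset.subset_insert _ _) fun G hG _ hH hlt =>
    (Finset.mem_insert.1 hH).resolve_left fun h => (hmax G hG).not_gt (h ▸ hlt)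

theorem mul_prod_X_mem_iff (K : Type*) [Field K] {F : Finset V} {ℋ : Finset (Finset V)}
    (h : IsLinearQuotientOrder (insert F ℋ) key T) (hF : F ∉ ℋ) (hmax : ∀ G ∈ ℋ, key G ≤ key F)
    {p : MvPolynomial V K} :
    p * ∏ v ∈ F, X v ∈ squarefreeIdeal K (ℋ : Set (Finset V)) ↔
      p ∈ Ideal.span (X '' (T F : Set V) : Set (MvPolynomial V K)) := by
  have hFi := Finset.mem_insert_self F ℋ
  constructor
  · intro hp
    rw [mem_ideal_span_X_image]
    intro a ha
    obtain ⟨G, hG, hsub⟩ := squarefreeIdeal.mem_iff.1 hp (a + exponent F) (by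
      rw [mem_support_iff, prod_X_eq, coeff_mul_monomial, mul_one]
      exact mem_support_iff.1 ha)
    obtain ⟨v, hv, hvG⟩ := h.meets F hFi G (Finset.mem_insert_of_mem hG)
      (fun e => hF (e ▸ hG)) (hmax G hG)
    refine ⟨v, hv, fun h0 => ?_⟩
    have := Finsupp.mem_support_iff.1 (hsub hvG)
    rw [Finsupp.add_apply, h0, exponent_apply,
      if_neg (Finset.disjoint_left.1 (h.disjoint F hFi) hv)] at this
    exact this rfl
  · intro hp
    have : Ideal.span (X '' (T F : Set V)) ≤ (squarefreeIdeal K (ℋ : Set (Finset V))).colon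
        {∏ v ∈ F, X v} := by
      rw [Ideal.span_le]
      rintro _ ⟨v, hv, rfl⟩
      obtain ⟨G, hG, hlt, hsub⟩ := h.attach F hFi v hv
      refine Submodule.mem_colon_singleton.2 (X_mul_prod_X_mem_iff.2 ⟨G, ?_, hsub⟩)
      exact (Finset.mem_insert.1 hG).resolve_left fun e => hlt.ne (e ▸ rfl)
    exact Submodule.mem_colon_singleton.1 (this hp)

/-- Sorting the generators by degree preserves linear quotients. -/
theorem sort_by_card (h : IsLinearQuotientOrder 𝒢 key T)
    (hanti : ∀ F ∈ 𝒢, ∀ G ∈ 𝒢, G ⊆ F → G = F) :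
    IsLinearQuotientOrder 𝒢 (fun F => toLex (F.card, key F)) T := by
  have hcard : ∀ F ∈ 𝒢, ∀ v ∈ T F, ∀ G ∈ 𝒢, key G < key F → G ⊆ insert v F → G.card ≤ F.card := by
    intro F hF v hv G hG hlt hsub
    have hvF := Finset.disjoint_left.1 (h.disjoint F hF) hv
    have hss : G ⊂ insert v F := by
      refine hsub.ssubset_of_ne fun e => hlt.ne ?_
      rw [hanti G hG F hF (e ▸ Finset.subset_insert v F)]
    have := Finset.card_lt_card hss
    rw [Finset.card_insert_of_notMem hvF] at this
    omega
  refine ⟨h.disjoint, fun F hF G hG hne hle => ?_, fun F hF v hv => ?_⟩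
  · rcases le_or_gt (key G) (key F) with hk | hk
    · exact h.meets F hF G hG hne hk
    have hGF : G.card < F.card := by
      rcases Prod.Lex.toLex_le_toLex.1 hle with h | h
      · exact h
      · exact absurd h.2 hk.not_ge
    by_contra! hbad
    obtain ⟨G, hG, hmin⟩ := Finset.exists_min_image
      (𝒢.filter fun G => key F < key G ∧ G.card < F.card ∧ ∀ v ∈ T F, v ∉ G) key
      ⟨G, by simpa using ⟨hG, hk, hGF, hbad⟩⟩
    simp only [Finset.mem_filter] at hG hmin
    obtain ⟨hG, hk, hGF, hbad⟩ := hG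
    obtain ⟨v, hv, hvF⟩ := h.meets G hG F hF (by rintro rfl; exact hk.ne rfl) hk.le
    obtain ⟨H, hH, hlt, hsub⟩ := h.attach G hG v hv
    have hHF : H.card < F.card := (hcard G hG v hv H hH hlt hsub).trans_lt hGF
    have hbadH : ∀ w ∈ T F, w ∉ H := by
      intro w hw hwH
      rcases Finset.mem_insert.1 (hsub hwH) with rfl | hwG
      · exact Finset.disjoint_left.1 (h.disjoint F hF) hw hvF
      · exact hbad w hw hwG
    rcases le_or_gt (key H) (key F) with hkH | hkH
    · obtain ⟨w, hw, hwH⟩ := h.meets F hF H hH (by rintro rfl; exact hHF.ne rfl) hkH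
      exact hbadH w hw hwH
    · exact (hmin H ⟨hH, hkH, hHF, hbadH⟩).not_gt hlt
  · obtain ⟨G, hG, hlt, hsub⟩ := h.attach F hF v hv
    refine ⟨G, hG, Prod.Lex.toLex_lt_toLex.2 ?_, hsub⟩
    rcases (hcard F hF v hv G hG hlt hsub).lt_or_eq with h | h
    · exact Or.inl h
    · exact Or.inr ⟨h, hlt⟩

end

end IsLinearQuotientOrder

namespace IsLinearQuotientOrder

open MvPolynomial squarefreeIdeal Koszul

section LowerBound

variable {ι V : Type*} [LinearOrder V] [Fintype V] [LinearOrder ι] {𝒢 : Finset (Finset V)}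
  {key : Finset V → ι} {T : Finset V → Finset V}

/-- The Koszul homology of `squarefreeIdeal K 𝒢` vanishes in internal degrees larger than those of
the generators. -/
theorem exists_boundary_eq_of_card_lt (K : Type*) [Field K]
    (h : IsLinearQuotientOrder 𝒢 key T) {e : ℕ}
    (he : ∀ F ∈ 𝒢, F.card < e) {z : Finset V → MvPolynomial V K}
    (hz : boundary (X (R := K)) z = 0) (hze : ∀ τ, (z τ).IsHomogeneous e)
    (hzI : ∀ τ, z τ ∈ squarefreeIdeal K (𝒢 : Set (Finset V))) :
    ∃ y, (∀ τ, y τ ∈ squarefreeIdeal K (𝒢 : Set (Finset V))) ∧ boundary (X (R := K)) y = z := by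
  induction 𝒢 using Finset.induction_on_max_value key generalizing z with
  | empty =>
    refine ⟨0, by simp, ?_⟩
    ext τ : 1
    have : z τ = 0 := by simpa [squarefreeIdeal] using hzI τ
    simp [this]
  | insert F ℋ hF hmax ih =>
    set m : MvPolynomial V K := ∏ v ∈ F, X v with hm
    have hmem : m ∈ squarefreeIdeal K ((insert F ℋ : Finset (Finset V)) : Set (Finset V)) :=
      prod_X_mem (by simp)
    have hcolon : ∀ {p : MvPolynomial V K}, p * m ∈ squarefreeIdeal K (ℋ : Set (Finset V)) ↔
        p ∈ Ideal.span (X '' (T F : Set V) : Set (MvPolynomial V K)) :=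
      h.mul_prod_X_mem_iff K hF hmax
    have hle : squarefreeIdeal K (ℋ : Set (Finset V)) ≤
        squarefreeIdeal K ((insert F ℋ : Finset (Finset V)) : Set (Finset V)) :=
      squarefreeIdeal.mono (by simp)
    obtain ⟨c, hc⟩ := Nat.exists_eq_add_of_lt (he F (Finset.mem_insert_self _ _))
    set w : Finset V → MvPolynomial V K := fun τ => (z τ).divMonomial (exponent F) with hw
    set z' : Finset V → MvPolynomial V K := fun τ => (z τ).modMonomial (exponent F) with hz'
    have hzw : z = m • w + z' := by
      ext τ : 1
      simp only [hw, hz', hm, prod_X_eq, Pi.add_apply, Pi.smul_apply, smul_eq_mul,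
        divMonomial_add_modMonomial]
    have hz'I : ∀ τ, z' τ ∈ squarefreeIdeal K (ℋ : Set (Finset V)) := by
      intro τ
      rw [squarefreeIdeal.mem_iff]
      intro a ha
      rw [mem_support_iff] at ha
      have hFa : ¬ exponent F ≤ a := fun hle => ha (coeff_modMonomial_of_le _ hle)
      rw [coeff_modMonomial_of_not_le _ hFa] at ha
      obtain ⟨G, hG, hsub⟩ := squarefreeIdeal.mem_iff.1 (hzI τ) a (mem_support_iff.2 ha)
      refine ⟨G, (Finset.mem_insert.1 hG).resolve_left ?_, hsub⟩
      rintro rfl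
      exact hFa (exponent_le_iff.2 hsub)
    have hwe : ∀ τ, (w τ).IsHomogeneous (c + 1) := by
      intro τ a ha
      rw [coeff_divMonomial] at ha
      have := hze τ ha
      have hdeg := isHomogeneous_prod_X (K := K) F (d := exponent F) (by simp [prod_X_eq])
      rw [map_add, hdeg, hc] at this
      omega
    have hz'e : ∀ τ, (z' τ).IsHomogeneous e := by
      intro τ a ha
      by_cases hFa : exponent F ≤ a
      · exact absurd (coeff_modMonomial_of_le _ hFa) ha
      · rw [coeff_modMonomial_of_not_le _ hFa] at ha
        exact hze τ ha
    have hbw : ∀ τ, boundary (X (R := K)) w τ ∈ Ideal.span (X '' (T F : Set V)) := by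
      intro τ
      rw [← hcolon]
      have h1 : boundary (X (R := K)) w τ * m = -boundary (X (R := K)) z' τ := by
        have := congr_fun hz τ
        rw [hzw, map_add, map_smul, Pi.add_apply, Pi.smul_apply, smul_eq_mul, mul_comm] at this
        exact eq_neg_of_add_eq_zero_left this
      rw [h1]
      exact neg_mem (boundary_mem X _ hz'I τ)
    obtain ⟨y, hye, hy⟩ := exists_boundary_sub X divX divX_X_smul_self divX_X_smul_of_ne divX_comm
      (Ideal.span (X '' (T F : Set V)) : Ideal (MvPolynomial V K))
      (homogeneousSubmodule V K (c + 1)).toAddSubgroup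
      (fun u v p hp => isHomogeneous_X_smul_divX u v hp) (T F)ᶜ
      (fun u hu p hp => divX_mem_span_X (by simpa using hu) hp) w hwe hbw
    have hr : ∀ τ, (w - boundary (X (R := K)) y) τ ∈ Ideal.span (X '' (T F : Set V)) := fun τ =>
      mem_span_X_of_divX_mem c.succ_ne_zero (hye τ) fun u hu => (hy τ).2 u (by simpa using hu)
    have hsplit : z - boundary (X (R := K)) (m • y) = m • (w - boundary (X (R := K)) y) + z' := by
      rw [map_smul, hzw, smul_sub]; abel
    obtain ⟨y', hy'I, hy'⟩ := ih (h.of_insert hmax)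
      (fun G hG => he G (Finset.mem_insert_of_mem hG)) (z := z - boundary (X (R := K)) (m • y))
      (by rw [map_sub, hz, boundary_boundary, sub_zero])
      (fun τ => by
        rw [hsplit]
        refine IsHomogeneous.add ?_ (hz'e τ)
        have : F.card + (c + 1) = e := by omega
        exact this ▸ (isHomogeneous_prod_X F).mul (hye τ))
      (fun τ => by
        rw [hsplit]
        refine add_mem ?_ (hz'I τ)
        rw [Pi.smul_apply, smul_eq_mul, mul_comm]
        exact hcolon.2 (hr τ))
    refine ⟨m • y + y', fun τ => add_mem ?_ (hle (hy'I τ)), ?_⟩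
    · rw [Pi.smul_apply, smul_eq_mul]
      exact Ideal.mul_mem_right _ _ hmem
    · rw [map_add, hy']; abel

end LowerBound

/-- The colon ideals bound the projective dimension from below. -/
theorem card_le_of_hasProjDimLE {K V : Type} {ι : Type*} [Field K] [LinearOrder V] [Fintype V]
    [LinearOrder ι] {𝒢 : Finset (Finset V)} {key : Finset V → ι} {T : Finset V → Finset V}
    (h : IsLinearQuotientOrder 𝒢 key T) (hanti : ∀ F ∈ 𝒢, ∀ G ∈ 𝒢, G ⊆ F → G = F)
    (hcard : ∀ F ∈ 𝒢, ∀ G ∈ 𝒢, key G < key F → G.card ≤ F.card) {p : ℕ}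
    (hp : HasProjDimLE (MvPolynomial V K) p (squarefreeIdeal K (𝒢 : Set (Finset V))))
    {F : Finset V} (hF : F ∈ 𝒢) : (T F).card ≤ p := by
  by_contra! hlt
  set ℋ := 𝒢.filter (key · < key F) with hℋ
  have hsub : ℋ ⊆ 𝒢 := Finset.filter_subset _ _
  set m : MvPolynomial V K := ∏ v ∈ F, X v with hm
  let c : Finset V → MvPolynomial V K := fun τ => if τ = T F then m else 0
  have hterm : ∀ τ, ∀ u ∈ τᶜ, X u * c (insert u τ) ∈ squarefreeIdeal K (ℋ : Set (Finset V)) ∧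
      (X u * c (insert u τ)).IsHomogeneous (F.card + 1) := by
    intro τ u _
    by_cases hu : insert u τ = T F
    · simp only [c, if_pos hu]
      refine ⟨X_mul_prod_X_mem_iff.2 ?_, ?_⟩
      · obtain ⟨G, hG, hGF, hs⟩ := h.attach F hF u (hu ▸ Finset.mem_insert_self u τ)
        exact ⟨G, by simpa [hℋ] using ⟨hG, hGF⟩, hs⟩
      · rw [add_comm]
        exact (isHomogeneous_X K u).mul (isHomogeneous_prod_X F)
    · simp only [c, if_neg hu, mul_zero]
      exact ⟨zero_mem _, isHomogeneous_zero V K _⟩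
  obtain ⟨y, hyI, hy⟩ := exists_boundary_eq_of_card_lt K
    (h.of_subset hsub fun G hG H hH hlt => by
      simp only [hℋ, Finset.mem_filter] at hG ⊢
      exact ⟨hH, hlt.trans hG.2⟩)
    (e := F.card + 1) (fun G hG => by
      simp only [hℋ, Finset.mem_filter] at hG
      exact Nat.lt_succ_of_le (hcard F hF G hG.1 hG.2))
    (boundary_boundary (X (R := K)) c)
    (fun τ => (homogeneousSubmodule V K _).sum_mem fun u hu => zsmul_mem (hterm τ u hu).2 _)
    (fun τ => Ideal.sum_mem _ fun u hu => zsmul_mem (hterm τ u hu).1 _)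
  have hlow : ∀ τ : Finset V, τ.card < p → boundary (X (R := K)) c τ = 0 := by
    intro τ hτ
    refine Finset.sum_eq_zero fun u _ => ?_
    have : insert u τ ≠ T F := fun e => by
      have := Finset.card_insert_le u τ
      rw [e] at this
      omega
    simp [c, this]
  have hy' : boundary (X (R := K)) (truncate p y) = boundary (X (R := K)) c := by
    rw [boundary_truncate X (by rwa [hy]), hy]
  have hI : ∀ τ, c τ - truncate p y τ ∈ squarefreeIdeal K (𝒢 : Set (Finset V)) := by
    intro τ
    refine sub_mem ?_ ?_
    · simp only [c]
      split_ifs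
      · exact prod_X_mem hF
      · exact zero_mem _
    · rw [truncate]
      split_ifs
      · exact zero_mem _
      · exact squarefreeIdeal.mono (Finset.coe_subset.2 hsub) (hyI τ)
  obtain ⟨w, hw⟩ := hp.exists_boundary_eq X divX divX_X_smul_self divX_X_smul_of_ne divX_comm
    (z := fun τ => ⟨c τ - truncate p y τ, hI τ⟩)
    (by
      ext τ : 2
      have := congr_fun (boundary_comp X (Submodule.subtype _)
        (fun τ => (⟨c τ - truncate p y τ, hI τ⟩ : squarefreeIdeal K (𝒢 : Set (Finset V))))) τ
      refine this.symm.trans ?_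
      change boundary (X (R := K)) (c - truncate p y) τ = 0
      rw [map_sub, hy', sub_self, Pi.zero_apply])
    (fun τ hτ => Subtype.ext (by
      have : τ ≠ T F := by rintro rfl; omega
      simp [c, this, truncate, hτ]))
  have hcoeff := congr_arg (fun v => coeff (exponent F) (v (T F)).1) hw
  have hyF : coeff (exponent F) (y (T F)) = 0 := by
    by_contra hne
    obtain ⟨G, hG, hGF⟩ := squarefreeIdeal.mem_iff.1 (hyI (T F)) _ (mem_support_iff.2 hne)
    have hGF' : G ⊆ F := fun v hv => by
      by_contra hvF
      exact Finsupp.mem_support_iff.1 (hGF hv) (by rw [exponent_apply, if_neg hvF])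
    obtain rfl := hanti F hF G (hsub hG) hGF'
    simp [hℋ] at hG
  have hcF : coeff (exponent F) (c (T F)) = 1 := by simp [c, hm, prod_X_eq]
  simp only [coeff_sub, truncate, if_neg hlt.not_ge, hyF, hcF, sub_zero] at hcoeff
  refine one_ne_zero (hcoeff.symm.trans ?_)
  rw [boundary_apply, AddSubmonoidClass.coe_finsetSum, coeff_sum]
  refine Finset.sum_eq_zero fun u _ => ?_
  have : coeff (exponent F) (X u * (w (insert u (T F))).1) = 0 := by
    by_contra hne
    rw [coeff_X_mul'] at hne
    split_ifs at hne with hu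
    · obtain ⟨G, hG, hGF⟩ :=
        squarefreeIdeal.mem_iff.1 (w (insert u (T F))).2 _ (mem_support_iff.2 hne)
      have hsupp : ∀ v ∈ G, v ∈ F ∧ v ≠ u := by
        intro v hv
        have := Finsupp.mem_support_iff.1 (hGF hv)
        rw [Finsupp.tsub_apply, exponent_apply, Finsupp.single_apply] at this
        constructor
        · by_contra hvF
          rw [if_neg hvF] at this
          omega
        · rintro rfl
          rw [if_pos rfl] at this
          split_ifs at this <;> omega
      obtain rfl := hanti F hF G hG fun v hv => (hsupp v hv).1
      refine (hsupp u ?_).2 rfl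
      by_contra huG
      exact Finsupp.mem_support_iff.1 hu (by rw [exponent_apply, if_neg huG])
    · exact hne rfl
  change coeff _ (sign u (T F) • (X u * (w (insert u (T F))).1)) = 0
  rw [← Int.cast_smul_eq_zsmul K, coeff_smul, this, smul_zero]

end IsLinearQuotientOrder

/-- The quotient by `k` variables has projective dimension at most `k`. -/
theorem hasProjDimLE_quotient_span_X {K V : Type} [Field K] [DecidableEq V] (T : Finset V) :
    HasProjDimLE (MvPolynomial V K) T.card
      (MvPolynomial V K ⧸ Ideal.span (MvPolynomial.X '' (T : Set V) : Set (MvPolynomial V K))) := by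
  induction T using Finset.induction_on with
  | empty =>
    refine (HasProjDimLE.of_projective 0 (MvPolynomial V K)).of_equiv ?_
    exact (Submodule.quotEquivOfEqBot _ (by simp)).symm
  | insert u T hu ih =>
    rw [Finset.card_insert_of_notMem hu]
    set J : Ideal (MvPolynomial V K) := Ideal.span (MvPolynomial.X '' (T : Set V)) with hJ
    have hins : (Ideal.span (MvPolynomial.X '' (↑(insert u T) : Set V)) :
        Ideal (MvPolynomial V K)) = Ideal.span {MvPolynomial.X u} ⊔ J := by
      rw [Finset.coe_insert, Set.image_insert_eq, Ideal.span_insert]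
    rw [hins]
    have hle : J ≤ Ideal.span {MvPolynomial.X u} ⊔ J := le_sup_right
    have hmul : ∀ p, p ∈ J → MvPolynomial.X u * p ∈ J := fun p hp => J.mul_mem_left _ hp
    refine HasProjDimLE.cokernel (LinearMap.lsmul (MvPolynomial V K) _ (MvPolynomial.X u))
      (Submodule.factor hle) ?_ (Submodule.factor_surjective hle) ?_ ih ih
    · rw [injective_iff_map_eq_zero]
      intro q hq
      obtain ⟨p, rfl⟩ := Submodule.Quotient.mk_surjective J q
      rw [LinearMap.lsmul_apply, ← Submodule.Quotient.mk_smul, Submodule.Quotient.mk_eq_zero,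
        smul_eq_mul, hJ, MvPolynomial.mem_ideal_span_X_image] at hq
      rw [Submodule.Quotient.mk_eq_zero, hJ, MvPolynomial.mem_ideal_span_X_image]
      intro a ha
      obtain ⟨v, hv, h⟩ := hq (Finsupp.single u 1 + a) (by simpa using ha)
      have : u ≠ v := fun e => hu (e ▸ hv)
      exact ⟨v, hv, by simpa [this] using h⟩
    · intro q
      obtain ⟨p, rfl⟩ := Submodule.Quotient.mk_surjective J q
      constructor
      · intro h
        have hp : p ∈ Ideal.span {MvPolynomial.X u} ⊔ J := (Submodule.Quotient.mk_eq_zero _).1 h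
        obtain ⟨a, ha, b, hb, rfl⟩ := Submodule.mem_sup.1 hp
        obtain ⟨a, rfl⟩ := Ideal.mem_span_singleton.1 ha
        refine ⟨Submodule.Quotient.mk a, ?_⟩
        rw [LinearMap.lsmul_apply, ← Submodule.Quotient.mk_smul, Submodule.Quotient.eq,
          smul_eq_mul]
        simpa using hb
      · rintro ⟨q, hq⟩
        obtain ⟨a, rfl⟩ := Submodule.Quotient.mk_surjective J q
        rw [← hq, LinearMap.lsmul_apply, ← Submodule.Quotient.mk_smul]
        refine (Submodule.Quotient.mk_eq_zero _).2 (Ideal.mem_sup_left ?_)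
        exact Ideal.mul_mem_right _ _ (Ideal.mem_span_singleton_self _)

/-- The colon ideals bound the projective dimension from above. -/
theorem IsLinearQuotientOrder.hasProjDimLE {K V : Type} {ι : Type*} [Field K] [DecidableEq V]
    [LinearOrder ι] {𝒢 : Finset (Finset V)} {key : Finset V → ι} {T : Finset V → Finset V}
    (h : IsLinearQuotientOrder 𝒢 key T) {N : ℕ} (hN : ∀ F ∈ 𝒢, (T F).card ≤ N) :
    HasProjDimLE (MvPolynomial V K) N (squarefreeIdeal K (𝒢 : Set (Finset V))) := by
  induction 𝒢 using Finset.induction_on_max_value key with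
  | empty =>
    have : squarefreeIdeal K ((∅ : Finset (Finset V)) : Set (Finset V)) = ⊥ := by
      simp [squarefreeIdeal]
    rw [this]
    exact HasProjDimLE.of_projective _ _
  | insert F ℋ hF hmax ih =>
    set A := squarefreeIdeal K (ℋ : Set (Finset V)) with hA
    set B := squarefreeIdeal K ((insert F ℋ : Finset (Finset V)) : Set (Finset V)) with hB
    have hAB : A ≤ B := squarefreeIdeal.mono (by simp)
    let m : B := ⟨∏ v ∈ F, MvPolynomial.X v, squarefreeIdeal.prod_X_mem (by simp)⟩
    let A' : Submodule (MvPolynomial V K) B := Submodule.comap B.subtype A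
    let g : MvPolynomial V K →ₗ[MvPolynomial V K] B ⧸ A' :=
      A'.mkQ ∘ₗ LinearMap.toSpanSingleton (MvPolynomial V K) B m
    have hker : LinearMap.ker g = Ideal.span (MvPolynomial.X '' (T F : Set V)) := by
      ext p
      rw [← h.mul_prod_X_mem_iff K hF hmax]
      exact Submodule.Quotient.mk_eq_zero A'
    have hg : Function.Surjective g := by
      intro q
      obtain ⟨⟨b, hb⟩, rfl⟩ := Submodule.Quotient.mk_surjective A' q
      have hb' := hb
      rw [hB, squarefreeIdeal, Finset.coe_insert, Set.image_insert_eq, Ideal.mem_span_insert] at hb'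
      obtain ⟨a, c, hc, rfl⟩ := hb'
      refine ⟨a, (Submodule.Quotient.eq A').2 ?_⟩
      change a * _ - (a * _ + c) ∈ A
      rw [sub_add_cancel_left]
      exact neg_mem hc
    have hq : HasProjDimLE (MvPolynomial V K) N (B ⧸ A') := by
      refine ((hasProjDimLE_quotient_span_X (T F)).mono
        (hN F (Finset.mem_insert_self _ _))).of_equiv ?_
      exact (Submodule.quotEquivOfEq _ _ hker.symm).trans (g.quotKerEquivOfSurjective hg)
    have hex : Function.Exact A'.subtype A'.mkQ := LinearMap.exact_subtype_mkQ A'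
    refine HasProjDimLE.extension (A := A') (B := B) (C := B ⧸ A') A'.subtype A'.mkQ
      A'.subtype_injective A'.mkQ_surjective hex ?_ hq
    exact (ih (h.of_insert hmax) fun G hG => hN G (Finset.mem_insert_of_mem hG)).of_equiv
      (Submodule.comapSubtypeEquivOfLe hAB).symm

/-- Linear quotients of the facet ideal, with the colon ideals recorded combinatorially. -/
theorem HasLinearQuotients.exists_isLinearQuotientOrder {K V : Type*} [Field K] [DecidableEq V]
    [Fintype V] {Δ : Set (Finset V)} (h : HasLinearQuotients K Δ) :
    ∃ (𝒢 : Finset (Finset V)) (key : Finset V → ℕ) (T : Finset V → Finset V),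
      (𝒢 : Set (Finset V)) = {F | IsFacet Δ F} ∧ IsLinearQuotientOrder 𝒢 key T := by
  classical
  obtain ⟨m, f, hf, hrange, hcolon⟩ := h
  have key_apply : ∀ i, Function.extend f Fin.val 0 (f i) = i := fun i => hf.extend_apply _ _ i
  have hfacet : ∀ i, IsFacet Δ (f i) := fun i => by
    have : f i ∈ {F | IsFacet Δ F} := hrange ▸ Set.mem_range_self i
    exact this
  have hT : ∀ i : Fin m, ∃ T : Finset V,
      (∀ j < i, ∃ v ∈ T, v ∈ f j) ∧ ∀ v ∈ T, ∃ j < i, f j ⊆ insert v (f i) := by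
    intro i
    obtain hi | hi := Nat.eq_zero_or_pos i.val
    · exact ⟨∅, fun j hj => absurd (Fin.lt_def.1 hj) (by omega), by simp⟩
    · obtain ⟨T, hT⟩ := hcolon i hi
      have hmem : ∀ p : MvPolynomial V K, p ∈ Ideal.span (MvPolynomial.X '' T) ↔
          p * ∏ v ∈ f i, MvPolynomial.X v ∈
            squarefreeIdeal K {F | ∃ j : Fin m, j < i ∧ f j = F} := fun p => by
        rw [← hT]
        exact Submodule.mem_colon_span_singleton
      refine ⟨T.toFinset, fun j hj => ?_, fun v hv => ?_⟩
      · have hp := (hmem (∏ v ∈ f j, MvPolynomial.X v)).2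
          (Ideal.mul_mem_right _ _ (squarefreeIdeal.prod_X_mem ⟨j, hj, rfl⟩))
        rw [MvPolynomial.mem_ideal_span_X_image, squarefreeIdeal.prod_X_eq] at hp
        obtain ⟨v, hv, hne⟩ := hp (squarefreeIdeal.exponent (f j)) (by simp)
        refine ⟨v, Set.mem_toFinset.2 hv, ?_⟩
        by_contra hvj
        exact hne (by rw [squarefreeIdeal.exponent_apply, if_neg hvj])
      · obtain ⟨_, ⟨j, hj, rfl⟩, hsub⟩ := squarefreeIdeal.X_mul_prod_X_mem_iff.1
          ((hmem (MvPolynomial.X v)).1 (Ideal.subset_span ⟨v, Set.mem_toFinset.1 hv, rfl⟩))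
        exact ⟨j, hj, hsub⟩
  choose T hmeets hattach using hT
  have T_apply : ∀ i, Function.extend f T (fun _ => ∅) (f i) = T i :=
    fun i => hf.extend_apply _ _ i
  refine ⟨Finset.univ.image f, Function.extend f Fin.val 0, Function.extend f T fun _ => ∅,
    by simpa using hrange, ?_, ?_, ?_⟩
  · simp only [Finset.mem_image, Finset.mem_univ, true_and, forall_exists_index,
      forall_apply_eq_imp_iff, T_apply]
    intro i
    refine Finset.disjoint_left.2 fun v hv hvi => ?_
    obtain ⟨j, hj, hsub⟩ := hattach i v hv
    rw [Finset.insert_eq_of_mem hvi] at hsub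
    exact hj.ne (hf ((hfacet j).2 _ (hfacet i).1 hsub))
  · simp only [Finset.mem_image, Finset.mem_univ, true_and, forall_exists_index,
      forall_apply_eq_imp_iff, T_apply, key_apply]
    intro i j hne hle
    exact hmeets i j ((Fin.le_def.2 hle).lt_of_ne fun e => hne (e ▸ rfl))
  · simp only [Finset.mem_image, Finset.mem_univ, true_and, forall_exists_index,
      forall_apply_eq_imp_iff, T_apply, key_apply]
    intro i v hv
    obtain ⟨j, hj, hsub⟩ := hattach i v hv
    exact ⟨f j, ⟨j, rfl⟩, by rw [key_apply]; exact hj, hsub⟩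

/-- The facets of the expansion are the transversal lifts of the facets. -/
theorem isFacet_expansion_iff {V : Type*} [DecidableEq V] {Δ : Set (Finset V)} {s : ℕ}
    (hs : 1 ≤ s) {G : Finset ((_ : V) × Fin s)} (hΔ : IsComplex Δ) :
    IsFacet (expansion Δ fun _ => s) G ↔
      IsFacet Δ (G.image Sigma.fst) ∧ Set.InjOn Sigma.fst (G : Set ((_ : V) × Fin s)) := by
  have hmem : ∀ H : Finset ((_ : V) × Fin s), H ∈ expansion Δ (fun _ => s) ↔
      H.image Sigma.fst ∈ Δ ∧ Set.InjOn Sigma.fst (H : Set ((_ : V) × Fin s)) := by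
    intro H
    simp only [expansion, simplexExpansion, Set.mem_iUnion, Set.mem_ofPred_eq, exists_prop]
    exact ⟨fun ⟨F, hF, hsub, hinj⟩ => ⟨hΔ hF hsub, hinj⟩,
      fun ⟨hF, hinj⟩ => ⟨_, hF, subset_rfl, hinj⟩⟩
  simp only [IsFacet, hmem]
  constructor
  · rintro ⟨⟨hG, hinj⟩, hmax⟩
    refine ⟨⟨hG, fun F hF hsub => hsub.antisymm fun v hv => ?_⟩, hinj⟩
    by_contra hvG
    have hmax' := hmax (insert ⟨v, ⟨0, hs⟩⟩ G) ⟨hΔ hF ?_, ?_⟩ (Finset.subset_insert _ _)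
    · exact hvG (Finset.mem_image.2 ⟨_, hmax' ▸ Finset.mem_insert_self _ _, rfl⟩)
    · rw [Finset.image_insert]
      exact Finset.insert_subset hv hsub
    · rw [Finset.coe_insert, Set.injOn_insert]
      · exact ⟨hinj, fun h => hvG (by simpa using h)⟩
      · exact fun h => hvG (Finset.mem_image_of_mem _ h)
  · rintro ⟨⟨hG, hmax⟩, hinj⟩
    refine ⟨⟨hG, hinj⟩, fun H ⟨hH, hHinj⟩ hsub => hsub.antisymm fun p hp => ?_⟩
    have hp' : p.1 ∈ G.image Sigma.fst :=
      hmax _ hH (Finset.image_subset_image hsub) ▸ Finset.mem_image_of_mem _ hp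
    obtain ⟨q, hq, hqp⟩ := Finset.mem_image.1 hp'
    exact hHinj (hsub hq) hp hqp ▸ hq

namespace IsLinearQuotientOrder

section Expansion

variable {V ι : Type*} [DecidableEq V] [LinearOrder ι] {𝒢 : Finset (Finset V)}
  {key : Finset V → ι} {T : Finset V → Finset V} {s : ℕ}

/-- The vertices generating the colon ideals of the expansion. -/
def expansionColon (T : Finset V → Finset V) (G : Finset ((_ : V) × Fin s)) :
    Finset ((_ : V) × Fin s) :=
  (T (G.image Sigma.fst)).sigma (fun _ => Finset.univ) ∪
    G.biUnion fun q => (Finset.Iio q.2).map (Function.Embedding.sigmaMk q.1)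

theorem mem_expansionColon {G : Finset ((_ : V) × Fin s)} {p : (_ : V) × Fin s} :
    p ∈ expansionColon T G ↔
      p.1 ∈ T (G.image Sigma.fst) ∨ ∃ q ∈ G, q.1 = p.1 ∧ p.2 < q.2 := by
  obtain ⟨v, k⟩ := p
  simp only [expansionColon, Finset.mem_union, Finset.mem_sigma, Finset.mem_univ, and_true,
    Finset.mem_biUnion, Finset.mem_map, Finset.mem_Iio, Function.Embedding.sigmaMk_apply,
    Sigma.mk.injEq, heq_eq_eq]
  refine or_congr_right (exists_congr fun q => and_congr_right fun _ => ?_)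
  exact ⟨fun ⟨_, hlt, h1, h2⟩ => ⟨h1, h2 ▸ hlt⟩, fun ⟨h1, h2⟩ => ⟨k, h2, h1, rfl⟩⟩

theorem card_expansionColon_le (G : Finset ((_ : V) × Fin s)) :
    (expansionColon T G).card ≤ (T (G.image Sigma.fst)).card * s + G.card * (s - 1) := by
  refine (Finset.card_union_le _ _).trans (add_le_add (by simp) ?_)
  refine Finset.card_biUnion_le_card_mul _ _ _ fun q _ => ?_
  rw [Finset.card_map, Fin.card_Iio]
  omega

/-- Linear quotients pass to the expansion. -/
theorem expand [Fintype V] (h : IsLinearQuotientOrder 𝒢 key T) (s : ℕ) :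
    IsLinearQuotientOrder
      {G : Finset ((_ : V) × Fin s) |
        G.image Sigma.fst ∈ 𝒢 ∧ Set.InjOn Sigma.fst (G : Set ((_ : V) × Fin s))}
      (fun G => toLex (key (G.image Sigma.fst), ∑ p ∈ G, p.2.val)) (expansionColon T) where
  disjoint G hG := by
    obtain ⟨hG, hinj⟩ := (Finset.mem_filter.1 hG).2
    refine Finset.disjoint_left.2 fun p hp hpG => ?_
    obtain hp | ⟨q, hq, hqp, hlt⟩ := mem_expansionColon.1 hp
    · exact Finset.disjoint_left.1 (h.disjoint _ hG) hp (Finset.mem_image_of_mem _ hpG)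
    · exact hlt.ne (hinj hq hpG hqp ▸ rfl)
  meets G hG H hH hne hle := by
    obtain ⟨hG, hGinj⟩ := (Finset.mem_filter.1 hG).2
    obtain ⟨hH, hHinj⟩ := (Finset.mem_filter.1 hH).2
    rw [Prod.Lex.toLex_le_toLex] at hle
    by_cases heq : H.image Sigma.fst = G.image Sigma.fst
    · simp only [heq, lt_irrefl, true_and, false_or] at hle
      by_contra! hno
      have hlow : ∀ p ∈ H, ∀ q ∈ G, q.1 = p.1 → q.2.val ≤ p.2.val := by
        intro p hp q hq hqp
        by_contra! hlt
        exact hno p (mem_expansionColon.2 (.inr ⟨q, hq, hqp, hlt⟩)) hp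
      have lift : ∀ p ∈ H, ∃ q ∈ G, q.1 = p.1 := fun p hp =>
        Finset.mem_image.1 (heq ▸ Finset.mem_image_of_mem _ hp)
      choose! φ hφG hφ using lift
      have hφinj : Set.InjOn φ (H : Set ((_ : V) × Fin s)) := fun p hp q hq hpq =>
        hHinj hp hq (by rw [← hφ p hp, ← hφ q hq, hpq])
      have himage : H.image φ = G := by
        refine Finset.eq_of_subset_of_card_le (Finset.image_subset_iff.2 hφG) ?_
        rw [Finset.card_image_of_injOn hφinj, ← Finset.card_image_of_injOn hGinj, ← heq]
        exact Finset.card_image_le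
      have hsum : ∑ p ∈ G, p.2.val = ∑ p ∈ H, (φ p).2.val := by
        rw [← himage, Finset.sum_image hφinj]
      have hterm : ∀ p ∈ H, (φ p).2.val ≤ p.2.val := fun p hp =>
        hlow p hp _ (hφG p hp) (hφ p hp)
      have hall := (Finset.sum_eq_sum_iff_of_le hterm).1
        ((Finset.sum_le_sum hterm).antisymm (hsum ▸ hle))
      refine hne ?_
      rw [← himage]
      conv_lhs => rw [← Finset.image_id (s := H)]
      refine Finset.image_congr fun p hp => ?_
      exact (Sigma.ext (hφ p hp) (heq_of_eq (Fin.ext (hall p hp)))).symm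
    · obtain ⟨v, hv, hvH⟩ := h.meets _ hG _ hH heq (by
        obtain hlt | hle := hle
        exacts [hlt.le, hle.1.le])
      obtain ⟨p, hp, rfl⟩ := Finset.mem_image.1 hvH
      exact ⟨p, mem_expansionColon.2 (.inl hv), hp⟩
  attach G hG p hp := by
    obtain ⟨hG, hinj⟩ := (Finset.mem_filter.1 hG).2
    obtain hp | ⟨q, hq, hqp, hlt⟩ := mem_expansionColon.1 hp
    · obtain ⟨F, hF, hlt, hsub⟩ := h.attach _ hG _ hp
      have hpG : p.1 ∉ G.image Sigma.fst := Finset.disjoint_left.1 (h.disjoint _ hG) hp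
      have himage : ((insert p G).filter (·.1 ∈ F)).image Sigma.fst = F := by
        ext v
        simp only [Finset.mem_image, Finset.mem_filter]
        constructor
        · rintro ⟨q, ⟨_, hq⟩, rfl⟩
          exact hq
        · intro hv
          have := hsub hv
          rw [← Finset.image_insert] at this
          obtain ⟨q, hq, rfl⟩ := Finset.mem_image.1 this
          exact ⟨q, ⟨hq, hv⟩, rfl⟩
      refine ⟨(insert p G).filter (·.1 ∈ F), ?_, ?_, Finset.filter_subset _ _⟩
      · refine Finset.mem_filter.2 ⟨Finset.mem_univ _, by rwa [himage], ?_⟩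
        refine Set.InjOn.mono (Finset.coe_subset.2 (Finset.filter_subset _ _)) ?_
        rw [Finset.coe_insert, Set.injOn_insert]
        · exact ⟨hinj, fun h => hpG (by simpa using h)⟩
        · exact fun h => hpG (Finset.mem_image_of_mem _ h)
      · rw [Prod.Lex.toLex_lt_toLex]
        exact .inl (by rwa [himage])
    · have hpG : p ∉ G.erase q := fun h =>
        hlt.ne (hinj hq (Finset.mem_of_mem_erase h) hqp ▸ rfl)
      have himage : (insert p (G.erase q)).image Sigma.fst = G.image Sigma.fst := by
        rw [Finset.image_insert, ← hqp, ← Finset.image_insert, Finset.insert_erase hq]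
      refine ⟨insert p (G.erase q), ?_, ?_,
        Finset.insert_subset_insert _ (Finset.erase_subset _ _)⟩
      · refine Finset.mem_filter.2 ⟨Finset.mem_univ _, himage ▸ hG, ?_⟩
        rw [Finset.coe_insert, Set.injOn_insert (by exact_mod_cast hpG)]
        refine ⟨hinj.mono (Finset.coe_subset.2 (Finset.erase_subset _ _)), ?_⟩
        rintro ⟨r, hr, hrp⟩
        have hr := Finset.mem_erase.1 (Finset.mem_coe.1 hr)
        exact hr.1 (hinj hr.2 hq (hrp.trans hqp.symm))
      · rw [Prod.Lex.toLex_lt_toLex]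
        refine .inr ⟨by rw [himage], ?_⟩
        rw [Finset.sum_insert hpG, ← Finset.add_sum_erase G _ hq]
        exact Nat.add_lt_add_right hlt _

end Expansion

end IsLinearQuotientOrder

/-- if `I(Δ)` has linear quotients, `dim Δ = d` and `α = (s,…,s)`, then
`pd(I(Δ^α)) ≤ pd(I(Δ))·s + (d+1)(s-1)`. -/
theorem projDim_facetIdeal_expansion_le (n : ℕ) (K : Type) [Field K]
    (Δ : Set (Finset (Fin n))) (hΔ : IsComplex Δ)
    (d : ℕ) (hd : IsGreatest {c : ℕ | ∃ F, IsFacet Δ F ∧ F.card = c} (d + 1))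
    (s : ℕ) (hs : 1 ≤ s)
    (hlq : HasLinearQuotients K Δ) :
    projDim (MvPolynomial ((_ : Fin n) × Fin s) K)
        (facetIdeal K (expansion Δ (fun _ => s)) : Ideal (MvPolynomial ((_ : Fin n) × Fin s) K)) ≤
      projDim (MvPolynomial (Fin n) K) (facetIdeal K Δ : Ideal (MvPolynomial (Fin n) K)) * (s : ℕ∞)
        + (((d + 1) * (s - 1) : ℕ) : ℕ∞) := by
  obtain ⟨𝒢, key, T, h𝒢, hT⟩ := hlq.exists_isLinearQuotientOrder
  have hfacet : ∀ F, F ∈ 𝒢 ↔ IsFacet Δ F := fun F => by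
    rw [← Finset.mem_coe, h𝒢, Set.mem_ofPred_eq]
  rcases Set.eq_empty_or_nonempty {k : ℕ∞ | ∃ p : ℕ, (p : ℕ∞) = k ∧
      HasProjDimLE (MvPolynomial (Fin n) K) p (facetIdeal K Δ)} with hempty | hne
  · have : projDim (MvPolynomial (Fin n) K) (facetIdeal K Δ) = ⊤ := by
      rw [projDim, hempty, sInf_empty]
    rw [this, ENat.top_mul (by exact_mod_cast (Nat.one_le_iff_ne_zero.1 hs)), top_add]
    exact le_top
  · obtain ⟨p, hpd, hp⟩ := csInf_mem hne
    have hpd : (p : ℕ∞) = projDim (MvPolynomial (Fin n) K) (facetIdeal K Δ) := hpd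
    have hp : HasProjDimLE (MvPolynomial (Fin n) K) p
        (squarefreeIdeal K (𝒢 : Set (Finset (Fin n)))) := by rwa [h𝒢]
    have hanti : ∀ F ∈ 𝒢, ∀ G ∈ 𝒢, G ⊆ F → G = F := fun F hF G hG hsub =>
      ((hfacet G).1 hG).2 F ((hfacet F).1 hF).1 hsub
    have hcard : ∀ F ∈ 𝒢, (T F).card ≤ p := fun F hF =>
      (hT.sort_by_card hanti).card_le_of_hasProjDimLE hanti (fun F _ G _ hlt => by
        rw [Prod.Lex.toLex_lt_toLex] at hlt
        obtain hlt | hlt := hlt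
        exacts [hlt.le, hlt.1.le]) hp hF
    rw [← hpd]
    refine sInf_le ⟨p * s + (d + 1) * (s - 1), by push_cast; rfl, ?_⟩
    have hset : {G | IsFacet (expansion Δ fun _ => s) G} =
        (({G : Finset ((_ : Fin n) × Fin s) | G.image Sigma.fst ∈ 𝒢 ∧
          Set.InjOn Sigma.fst (G : Set ((_ : Fin n) × Fin s))} : Finset _) : Set _) := by
      ext G
      simp [isFacet_expansion_iff hs hΔ, hfacet]
    have hideal : facetIdeal K (expansion Δ fun _ => s) = squarefreeIdeal K _ :=
      congr_arg (squarefreeIdeal K) hset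
    rw [hideal]
    refine (hT.expand s).hasProjDimLE fun G hG => ?_
    obtain ⟨hG, hinj⟩ := (Finset.mem_filter.1 hG).2
    refine (IsLinearQuotientOrder.card_expansionColon_le G).trans
      (add_le_add (Nat.mul_le_mul_right s (hcard _ hG)) (Nat.mul_le_mul_right (s - 1) ?_))
    rw [← Finset.card_image_of_injOn hinj]
    exact hd.2 ⟨_, (hfacet _).1 hG, rfl⟩
end
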